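/- arXiv:1003.1489 — 3 statements merged into one kernel-verified Lean document; each statement's English description precedes it below -/
import Mathlib

section
/- Let u be a special word of F(Σ,Q) of length n ≥ 3. Then one of the following holds: (1) u = a^n for some letter a ∈ Σ, or (2) u = φ_{a,N}(v)·a^{N'} for some letter a ∈ Σ, some integer N ≥ 2 all of whose prime divisors belong to Q, some 0 ≤ N' < N, and some v ∈ F(Σ,Q); moreover in case (2) the word v contains a letter b ≠ a and L(v) = L(u). -/
open Filter

/-- The Toeplitz morphism `φ_{a,m}` sending each letter `b` to `a^{m-1} b`,
extended to words. -/
def phi {A : Type*} (a : A) (m : ℕ) (w : List A) : List A :=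
  w.flatMap (fun b => List.replicate (m - 1) a ++ [b])

/-- The language `L(Σ,Q)`: the closure of the single letters under the
morphisms `φ_{a,q}` for `a ∈ Σ` and `q ∈ Q`. -/
inductive IsL {A : Type*} (Q : Finset ℕ) : List A → Prop
  | base (c : A) : IsL Q [c]
  | step (a : A) (q : ℕ) (hq : q ∈ Q) {w : List A} (hw : IsL Q w) : IsL Q (phi a q w)

/-- `F(Σ,Q)`: the factorial closure of `L(Σ,Q)`. -/
def FQ (A : Type*) (Q : Finset ℕ) : Set (List A) :=
  { u | ∃ v, IsL Q v ∧ u <:+: v }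

/-- The set `L(u)` of left extensions of `u` inside `F(Σ,Q)`. -/
def Lext (A : Type*) (Q : Finset ℕ) (u : List A) : Set A :=
  { a | (a :: u) ∈ FQ A Q }

/-- `u` is (left) special in `F(Σ,Q)`. -/
def IsSpecial (A : Type*) (Q : Finset ℕ) (u : List A) : Prop :=
  u ∈ FQ A Q ∧ (Lext A Q u).ncard ≠ 1

/-- The subword complexity `p(n)` of `F(Σ,Q)`. -/
noncomputable def pF (A : Type*) (Q : Finset ℕ) (n : ℕ) : ℕ :=
  Set.ncard { u ∈ FQ A Q | u.length = n }

/-- The first differences `s(n) = p(n+1) - p(n)`. -/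
noncomputable def sF (A : Type*) (Q : Finset ℕ) (n : ℕ) : ℤ :=
  (pF A Q (n + 1) : ℤ) - (pF A Q n : ℤ)

section Desubstitution

variable {A : Type*}

/-- All letters of `u` different from `a` occur at (one-based) positions divisible by `N`. -/
def IsSparse (a : A) (N : ℕ) (u : List A) : Prop :=
  ∀ i b, u[i]? = some b → b ≠ a → N ∣ i + 1

/-- The word formed by the letters of `u` at the (one-based) positions divisible by `N`. -/
def desub (N : ℕ) (u : List A) : List A :=
  List.ofFn fun i : Fin (u.length / N) => u[(i.1 + 1) * N - 1]'(by
    have h1 : (i.1 + 1) * N ≤ u.length :=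
      (Nat.mul_le_mul_right N i.2).trans (Nat.div_mul_le_self _ _)
    have h2 : 0 < N := by
      rcases Nat.eq_zero_or_pos N with h | h
      · have := i.2
        simp [h] at this
      · exact h
    have : 0 < (i.1 + 1) * N := Nat.mul_pos (Nat.succ_pos _) h2
    omega)

theorem getElem?_desub {N : ℕ} (hN : 0 < N) (u : List A) (i : ℕ) :
    (desub N u)[i]? = u[(i + 1) * N - 1]? := by
  have h0 : 0 < (i + 1) * N := Nat.mul_pos (Nat.succ_pos _) hN
  have h : i < u.length / N ↔ (i + 1) * N - 1 < u.length := by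
    rw [Nat.lt_iff_add_one_le, Nat.le_div_iff_mul_le hN]
    omega
  unfold desub
  by_cases hi : i < u.length / N
  · rw [List.getElem?_eq_getElem (h.1 hi), List.getElem?_eq_getElem (by simpa using hi)]
    simp
  · rw [List.getElem?_eq_none (by simpa using hi), List.getElem?_eq_none (by omega)]

theorem length_desub (N : ℕ) (u : List A) : (desub N u).length = u.length / N := by
  simp [desub]

theorem desub_one (u : List A) : desub 1 u = u := by
  apply List.ext_getElem?
  intro i
  rw [getElem?_desub one_pos]
  simp

theorem desub_desub {M N : ℕ} (hM : 0 < M) (hN : 0 < N) (u : List A) :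
    desub M (desub N u) = desub (M * N) u := by
  apply List.ext_getElem?
  intro i
  have : 0 < (i + 1) * M := Nat.mul_pos (Nat.succ_pos _) hM
  rw [getElem?_desub hM, getElem?_desub hN, getElem?_desub (Nat.mul_pos hM hN),
    Nat.sub_add_cancel this, mul_assoc]

theorem IsSparse.one (a : A) (u : List A) : IsSparse a 1 u := fun _ _ _ _ => one_dvd _

theorem IsSparse.of_dvd {a : A} {M N : ℕ} {u : List A} (h : IsSparse a N u) (hMN : M ∣ N) :
    IsSparse a M u := fun i b hb hba => hMN.trans (h i b hb hba)

theorem isSparse_mul_iff {a : A} {M N : ℕ} {u : List A} (hN : 0 < N) :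
    IsSparse a (M * N) u ↔ IsSparse a N u ∧ IsSparse a M (desub N u) := by
  constructor
  · intro h
    refine ⟨h.of_dvd (dvd_mul_left _ _), fun i b hb hba => ?_⟩
    rw [getElem?_desub hN] at hb
    have h0 : 0 < (i + 1) * N := Nat.mul_pos (Nat.succ_pos _) hN
    have := h _ b hb hba
    rw [Nat.sub_add_cancel h0] at this
    exact Nat.dvd_of_mul_dvd_mul_right hN this
  · rintro ⟨h, h'⟩ i b hb hba
    obtain ⟨j, hj⟩ := h i b hb hba
    obtain _ | j := j
    · simp at hj
    have hij : i = (j + 1) * N - 1 := by rw [mul_comm, ← hj]; rfl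
    rw [hij, ← getElem?_desub hN] at hb
    rw [hj, mul_comm N]
    exact Nat.mul_dvd_mul_right (h' j b hb hba) N

theorem exists_ne_desub {a : A} {N : ℕ} {u : List A} (hN : 0 < N) (h : IsSparse a N u)
    (hu : ∃ b ∈ u, b ≠ a) : ∃ b ∈ desub N u, b ≠ a := by
  obtain ⟨b, hb, hba⟩ := hu
  obtain ⟨i, hi⟩ := List.mem_iff_getElem?.1 hb
  obtain ⟨j, hj⟩ := h i b hi hba
  obtain _ | j := j
  · simp at hj
  refine ⟨b, List.mem_iff_getElem?.2 ⟨j, ?_⟩, hba⟩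
  rw [getElem?_desub hN, mul_comm, ← hj]
  exact hi

theorem phi_cons (a : A) (N : ℕ) (b : A) (w : List A) :
    phi a N (b :: w) = List.replicate (N - 1) a ++ b :: phi a N w := by
  simp [phi]

theorem phi_append (a : A) (N : ℕ) (v w : List A) :
    phi a N (v ++ w) = phi a N v ++ phi a N w := by
  simp [phi]

theorem getElem?_phi (a : A) {N : ℕ} (w : List A) (j : ℕ) {r : ℕ} (hr : r < N) :
    (phi a N w)[j * N + r]? = w[j]?.map fun b => if r + 1 = N then b else a := by
  induction w generalizing j with
  | nil => simp [phi]
  | cons b w ih =>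
    rw [phi_cons]
    cases j with
    | zero =>
      by_cases h : r + 1 = N
      · rw [List.getElem?_append_right (by simp; omega)]
        simp [← h]
      · rw [List.getElem?_append_left (by simp; omega)]
        rw [List.getElem?_replicate]
        simp [h]; omega
    | succ j =>
      have : (j + 1) * N + r - (N - 1) = (j * N + r) + 1 := by
        rw [add_mul]; omega
      rw [List.getElem?_append_right (by simp; rw [add_mul]; omega), List.length_replicate, this]
      simpa using ih j

theorem isSparse_phi (a : A) {N : ℕ} (hN : 0 < N) (w : List A) : IsSparse a N (phi a N w) := by
  intro i b hb hba
  have hr := Nat.mod_lt i hN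
  have hi : i / N * N + i % N = i := Nat.div_add_mod' i N
  rw [← hi, getElem?_phi a w _ hr] at hb
  by_cases h : i % N + 1 = N
  · rw [← hi, add_assoc, h]
    exact Dvd.intro_left (i / N + 1) (by ring)
  · simp only [h, if_false, Option.map_eq_some_iff] at hb
    obtain ⟨_, _, h'⟩ := hb
    exact absurd h'.symm hba

theorem desub_phi (a : A) {N : ℕ} (hN : 0 < N) (w : List A) : desub N (phi a N w) = w := by
  apply List.ext_getElem?
  intro i
  have : (i + 1) * N - 1 = i * N + (N - 1) := by rw [add_mul]; omega
  rw [getElem?_desub hN, this, getElem?_phi a w i (by omega)]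
  simp [Nat.sub_add_cancel hN]

theorem length_phi (a : A) {N : ℕ} (hN : 0 < N) (w : List A) :
    (phi a N w).length = w.length * N := by
  induction w with
  | nil => simp [phi]
  | cons b w ih => rw [phi_cons]; simp [ih, add_mul]; omega

theorem phi_desub {a : A} {N : ℕ} (hN : 0 < N) {u : List A} (h : IsSparse a N u) :
    phi a N (desub N u) ++ List.replicate (u.length % N) a = u := by
  have hlen : (phi a N (desub N u)).length = u.length / N * N := by
    rw [length_phi a hN, length_desub]
  have hdm := Nat.div_add_mod' u.length N
  apply List.ext_getElem
  · simp only [List.length_append, hlen, List.length_replicate, hdm]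
  intro i h1 h2
  have hi : i / N * N + i % N = i := Nat.div_add_mod' i N
  have key : ∀ h : ¬ N ∣ i + 1, u[i] = a := fun hd => by
    by_contra hne
    exact hd (h i _ (List.getElem?_eq_getElem h2) hne)
  apply Option.some_injective
  rw [← List.getElem?_eq_getElem, ← List.getElem?_eq_getElem]
  by_cases hlt : i < u.length / N * N
  · rw [List.getElem?_append_left (by omega), ← hi, getElem?_phi a _ _ (Nat.mod_lt i hN), hi,
      getElem?_desub hN]
    have hj : i / N < u.length / N := Nat.div_lt_of_lt_mul (by rwa [mul_comm])
    have hj' : (i / N + 1) * N - 1 < u.length := by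
      have := (Nat.mul_le_mul_right N hj).trans (Nat.div_mul_le_self _ _)
      have : 0 < (i / N + 1) * N := Nat.mul_pos (Nat.succ_pos _) hN
      simp only [Nat.succ_eq_add_one] at *
      omega
    by_cases hr : i % N + 1 = N
    · have : (i / N + 1) * N - 1 = i := by rw [add_mul]; omega
      simp [hr, this]
    · rw [List.getElem?_eq_getElem hj', List.getElem?_eq_getElem h2, key]
      · simp [hr]
      · intro hd
        rw [← hi, add_assoc, Nat.dvd_add_right (Dvd.intro_left _ rfl)] at hd
        have := Nat.le_of_dvd (Nat.succ_pos _) hd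
        have := Nat.mod_lt i hN
        omega
  · rw [List.getElem?_append_right (by omega), hlen, List.getElem?_replicate,
      if_pos (by omega), List.getElem?_eq_getElem h2, key]
    rintro ⟨k, hk⟩
    have hk1 : k ≤ u.length / N := (Nat.le_div_iff_mul_le hN).2 (by rw [mul_comm]; omega)
    have := Nat.mul_le_mul_right N hk1
    rw [mul_comm k] at this
    omega

theorem desub_drop {N : ℕ} (hN : 0 < N) (u : List A) (j : ℕ) :
    desub N (u.drop (j * N)) = (desub N u).drop j := by
  apply List.ext_getElem?
  intro i
  rw [getElem?_desub hN, List.getElem?_drop, List.getElem?_drop, getElem?_desub hN]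
  have : 0 < (i + 1) * N := Nat.mul_pos (Nat.succ_pos _) hN
  rw [add_assoc, add_mul j, Nat.add_sub_assoc this]

theorem desub_isPrefix {N : ℕ} (hN : 0 < N) {u v : List A} (h : u <+: v) :
    desub N u <+: desub N v := by
  rw [List.prefix_iff_getElem?] at h ⊢
  intro i hi
  have hs : u[(i + 1) * N - 1]? = some (desub N u)[i] := by
    rw [← getElem?_desub hN, List.getElem?_eq_getElem hi]
  obtain ⟨h1, h2⟩ := List.getElem?_eq_some_iff.1 hs
  rw [getElem?_desub hN, h _ h1, h2]

theorem IsSparse.drop {a : A} {N : ℕ} {u : List A} (h : IsSparse a N u) (j : ℕ) :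
    IsSparse a N (u.drop (j * N)) := by
  intro i b hb hba
  rw [List.getElem?_drop] at hb
  have := h _ b hb hba
  rwa [add_assoc, Nat.dvd_add_right (Dvd.intro_left _ rfl)] at this

theorem IsSparse.of_isPrefix {a : A} {N : ℕ} {u v : List A} (h : IsSparse a N v)
    (huv : u <+: v) : IsSparse a N u := by
  intro i b hb hba
  rw [List.prefix_iff_getElem?] at huv
  obtain ⟨h1, h2⟩ := List.getElem?_eq_some_iff.1 hb
  exact h i b (by rw [huv i h1, h2]) hba

end Desubstitution

section Language

variable {A : Type*} {Q : Finset ℕ}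

theorem mem_FQ_of_isInfix {u v : List A} (hv : v ∈ FQ A Q) (h : u <:+: v) : u ∈ FQ A Q := by
  obtain ⟨w, hw, hvw⟩ := hv
  exact ⟨w, hw, h.trans hvw⟩

theorem phi_mem_FQ {u : List A} (hu : u ∈ FQ A Q) (a : A) {q : ℕ} (hq : q ∈ Q) :
    phi a q u ∈ FQ A Q := by
  obtain ⟨w, hw, s, t, rfl⟩ := hu
  refine ⟨phi a q (s ++ u ++ t), hw.step a q hq, phi a q s, phi a q t, ?_⟩
  simp only [phi_append]

theorem singleton_mem_FQ (c : A) : [c] ∈ FQ A Q := ⟨[c], .base c, List.infix_rfl⟩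

theorem exists_mem_of_mem_FQ {u : List A} (hu : u ∈ FQ A Q) (hlen : 2 ≤ u.length) :
    ∃ q, q ∈ Q := by
  obtain ⟨v, hv, huv⟩ := hu
  cases hv with
  | base c => have := huv.length_le; simp at this; omega
  | step a q hq hw => exact ⟨q, hq⟩

theorem pair_mem_FQ {q : ℕ} (hq : q ∈ Q) (h2 : 2 ≤ q) (a b : A) : [a, b] ∈ FQ A Q := by
  refine mem_FQ_of_isInfix (phi_mem_FQ (singleton_mem_FQ b) a hq) ⟨List.replicate (q - 2) a, [], ?_⟩
  obtain ⟨q, rfl⟩ := Nat.exists_eq_add_of_le' h2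
  simp [phi, List.replicate_succ']

theorem phi_replicate (a : A) {q : ℕ} (hq : 0 < q) (n : ℕ) :
    phi a q (List.replicate n a) = List.replicate (n * q) a := by
  rw [List.eq_replicate_iff]
  refine ⟨by rw [length_phi a hq, List.length_replicate], fun b hb => ?_⟩
  simp only [phi, List.mem_flatMap, List.mem_append, List.mem_replicate, List.mem_singleton] at hb
  obtain ⟨_, ⟨_, rfl⟩, ⟨_, h⟩ | h⟩ := hb <;> exact h

theorem replicate_mem_FQ {q : ℕ} (hq : q ∈ Q) (h2 : 2 ≤ q) (a : A) (n : ℕ) :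
    List.replicate n a ∈ FQ A Q := by
  obtain ⟨m, hm, hmem⟩ : ∃ m, n < m ∧ List.replicate m a ∈ FQ A Q := by
    induction n with
    | zero => exact ⟨1, one_pos, singleton_mem_FQ a⟩
    | succ n ih =>
      obtain ⟨m, hm, hmem⟩ := ih
      refine ⟨m * q, by nlinarith, ?_⟩
      rw [← phi_replicate a (by omega)]
      exact phi_mem_FQ hmem a hq
  refine mem_FQ_of_isInfix hmem ⟨[], List.replicate (m - n) a, ?_⟩
  simp only [List.nil_append, List.replicate_append_replicate]
  congr 1
  omega

theorem exists_cons_mem_FQ {q : ℕ} (hq : q ∈ Q) (h2 : 2 ≤ q) {u : List A} (hu : u ∈ FQ A Q) :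
    ∃ x, x :: u ∈ FQ A Q := by
  obtain ⟨v, hv, s, t, rfl⟩ := hu
  obtain ⟨x, hx⟩ : ∃ x, x :: (s ++ u ++ t) ∈ FQ A Q := by
    generalize s ++ u ++ t = v at hv
    induction hv with
    | base c => exact ⟨c, pair_mem_FQ hq h2 c c⟩
    | step a r hr _ ih =>
      obtain ⟨x, hx⟩ := ih
      refine ⟨x, mem_FQ_of_isInfix (phi_mem_FQ hx a hr) ?_⟩
      rw [phi_cons]
      exact (List.suffix_append _ _).isInfix
  obtain ⟨s', y, hs⟩ : ∃ s' y, x :: s = s' ++ [y] :=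
    ⟨_, _, (List.dropLast_append_getLast (List.cons_ne_nil x s)).symm⟩
  refine ⟨y, mem_FQ_of_isInfix hx ⟨s', t, ?_⟩⟩
  have : x :: (s ++ u ++ t) = (x :: s) ++ u ++ t := by simp
  rw [this, hs]
  simp

theorem exists_concat_mem_FQ (hQ : ∀ q ∈ Q, 2 ≤ q) {q : ℕ} (hq : q ∈ Q)
    {u : List A} (hu : u ∈ FQ A Q) : ∃ x, u ++ [x] ∈ FQ A Q := by
  obtain ⟨v, hv, s, t, rfl⟩ := hu
  obtain ⟨x, hx⟩ : ∃ x, s ++ u ++ t ++ [x] ∈ FQ A Q := by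
    generalize s ++ u ++ t = v at hv
    induction hv with
    | base c => exact ⟨c, pair_mem_FQ hq (hQ q hq) c c⟩
    | step a r hr _ ih =>
      obtain ⟨x, hx⟩ := ih
      refine ⟨a, mem_FQ_of_isInfix (phi_mem_FQ hx a hr) ?_⟩
      obtain ⟨r, rfl⟩ := Nat.exists_eq_add_of_le' (hQ r hr)
      refine List.IsPrefix.isInfix ⟨List.replicate r a ++ [x], ?_⟩
      rw [phi_append]
      simp [phi, List.replicate_succ]
  obtain ⟨y, t', ht⟩ : ∃ y t', t ++ [x] = y :: t' := by
    cases t with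
    | nil => exact ⟨_, _, rfl⟩
    | cons y t => exact ⟨_, _, rfl⟩
  refine ⟨y, mem_FQ_of_isInfix hx ⟨s, t', ?_⟩⟩
  rw [List.append_assoc _ t, ht]
  simp

theorem cons_cons_mem_of_cons_desub_mem (hQ : ∀ q ∈ Q, 2 ≤ q) {a : A} {M : ℕ} (hM : M ∈ Q)
    {x : A} {u : List A} (hs : IsSparse a M u) (h : x :: desub M u ∈ FQ A Q) :
    a :: x :: u ∈ FQ A Q := by
  have h2 := hQ M hM
  obtain ⟨y, hy⟩ := exists_concat_mem_FQ hQ hM h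
  have hlt := Nat.mod_lt u.length (show 0 < M by omega)
  have hk : List.replicate (M - 1) a = List.replicate (u.length % M) a ++
      List.replicate (M - 1 - u.length % M) a := by
    rw [List.replicate_append_replicate]
    congr 1
    omega
  refine mem_FQ_of_isInfix (phi_mem_FQ hy a hM)
    ⟨List.replicate (M - 2) a, List.replicate (M - 1 - u.length % M) a ++ [y], ?_⟩
  have hM1 : List.replicate (M - 1) a = List.replicate (M - 2) a ++ [a] := by
    rw [← List.replicate_succ']
    congr 1
    omega
  calc
    _ = List.replicate (M - 1) a ++ x :: (phi a M (desub M u) ++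
          List.replicate (u.length % M) a) ++
          (List.replicate (M - 1 - u.length % M) a ++ [y]) := by
      rw [phi_desub (by omega) hs, hM1]
      simp
    _ = List.replicate (M - 1) a ++ x :: phi a M (desub M u) ++
          ((List.replicate (u.length % M) a ++ List.replicate (M - 1 - u.length % M) a) ++
            [y]) := by
      simp only [List.append_assoc, List.cons_append]
    _ = _ := by rw [← hk, phi_append, phi_cons]; simp [phi]

theorem cons_mem_of_cons_desub_mem (hQ : ∀ q ∈ Q, 2 ≤ q) {a : A} {M : ℕ} (hM : M ∈ Q)
    {x : A} {u : List A} (hs : IsSparse a M u) (h : x :: desub M u ∈ FQ A Q) :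
    x :: u ∈ FQ A Q :=
  mem_FQ_of_isInfix (cons_cons_mem_of_cons_desub_mem hQ hM hs h) (List.suffix_cons _ _).isInfix

theorem exists_isSparse_replicate_append (hQ : ∀ q ∈ Q, 2 ≤ q) {u : List A} (hu : u ∈ FQ A Q)
    (hlen : 2 ≤ u.length) : ∃ a, ∃ M ∈ Q, ∃ k < M, IsSparse a M (List.replicate k a ++ u) ∧
      desub M (List.replicate k a ++ u) ∈ FQ A Q := by
  obtain ⟨v, hv, s, t, hst⟩ := hu
  cases hv with
  | base c =>
    have := congrArg List.length hst
    simp at this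
    omega
  | @step a q hq w hw =>
    have h0 : 0 < q := by have := hQ q hq; omega
    have hk := Nat.mod_lt s.length h0
    have hsp := isSparse_phi a h0 w
    have hdm := Nat.div_add_mod' s.length q
    have hs : s.drop (s.length / q * q) = List.replicate (s.length % q) a := by
      rw [List.eq_replicate_iff]
      refine ⟨by rw [List.length_drop]; omega, fun b hb => ?_⟩
      obtain ⟨i, hi⟩ := List.mem_iff_getElem?.1 hb
      have hi' := (List.getElem?_eq_some_iff.1 hi).1
      rw [List.length_drop] at hi'
      rw [List.getElem?_drop] at hi
      by_contra hba
      have := hsp (s.length / q * q + i) b (by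
        rw [← hst, List.append_assoc, List.getElem?_append_left (by omega), hi]) hba
      rw [add_assoc, Nat.dvd_add_right (Dvd.intro_left _ rfl)] at this
      have := Nat.le_of_dvd (Nat.succ_pos _) this
      omega
    have hpre : List.replicate (s.length % q) a ++ u <+:
        (phi a q w).drop (s.length / q * q) := by
      refine ⟨t, ?_⟩
      rw [← hst, List.append_assoc s, List.drop_append_of_le_length (by omega), hs,
        List.append_assoc]
    refine ⟨a, q, hq, _, hk, (hsp.drop _).of_isPrefix hpre, w, hw, ?_⟩
    have := desub_isPrefix h0 hpre
    rw [desub_drop h0, desub_phi a h0] at this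
    exact this.isInfix.trans (List.drop_suffix _ _).isInfix

theorem IsSparse.dvd_of_replicate_append {a : A} {M k : ℕ} {u : List A}
    (h : IsSparse a M (List.replicate k a ++ u)) {i : ℕ} {b : A} (hb : u[i]? = some b)
    (hba : b ≠ a) : M ∣ k + i + 1 :=
  h (k + i) b (by rw [List.getElem?_append_right (by simp)]; simpa using hb) hba

theorem IsSparse.eq_or_eq_of_replicate_append {a : A} {M k : ℕ} {u : List A} (hM : 2 ≤ M)
    (h : IsSparse a M (List.replicate k a ++ u)) {i : ℕ} {b c : A} (hb : u[i]? = some b)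
    (hc : u[i + 1]? = some c) : b = a ∨ c = a := by
  by_contra! hne
  have h1 := h.dvd_of_replicate_append hb hne.1
  have h2 := h.dvd_of_replicate_append hc hne.2
  have : M ∣ 1 := (Nat.dvd_add_right h1).1 (by rwa [← add_assoc] at h2)
  have := Nat.le_of_dvd one_pos this
  omega

/-- A word `xu` of the language is either aligned with the end of a block of some morphism
`φ_{a,M}`, or starts strictly inside such a block. -/
theorem aligned_or_shifted (hQ : ∀ q ∈ Q, 2 ≤ q) {x : A} {u : List A}
    (h : x :: u ∈ FQ A Q) (hu : u ≠ []) : ∃ a, ∃ M ∈ Q,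
      (IsSparse a M u ∧ x :: desub M u ∈ FQ A Q) ∨
      (x = a ∧ ∃ k, 0 < k ∧ k < M ∧ IsSparse a M (List.replicate k a ++ u) ∧
        desub M (List.replicate k a ++ u) ∈ FQ A Q) := by
  have hlen := List.length_pos_iff.2 hu
  obtain ⟨a, M, hM, k, hk, hs, hd⟩ := exists_isSparse_replicate_append hQ h (by simp; omega)
  refine ⟨a, M, hM, ?_⟩
  have hM0 : 0 < M := by omega
  by_cases hkM : k + 1 = M
  · left
    have hdrop : (List.replicate k a ++ x :: u).drop (1 * M) = u := by
      rw [one_mul, ← hkM, List.append_cons]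
      exact List.drop_left' (by simp)
    refine ⟨hdrop ▸ hs.drop 1, ?_⟩
    have h0 : (desub M (List.replicate k a ++ x :: u))[0]? = some x := by
      rw [getElem?_desub hM0, List.getElem?_append_right (by simp; omega)]
      simp [← hkM]
    obtain ⟨h1, h2⟩ := List.getElem?_eq_some_iff.1 h0
    have := List.drop_eq_getElem_cons h1
    rw [List.drop_zero, h2, zero_add, ← desub_drop hM0, hdrop] at this
    exact this ▸ hd
  · right
    have hx : x = a := by
      by_contra hxa
      have := hs.dvd_of_replicate_append (i := 0) rfl hxa
      have := Nat.le_of_dvd (Nat.succ_pos _) this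
      omega
    subst hx
    have : List.replicate k x ++ x :: u = List.replicate (k + 1) x ++ u := by
      simp [List.replicate_succ']
    rw [this] at hs hd
    exact ⟨rfl, k + 1, by omega, by omega, hs, hd⟩

end Language

section Special

variable {A : Type*} {Q : Finset ℕ}

theorem IsSparse.getElem?_eq_of_not_dvd {a : A} {N i : ℕ} {u : List A} (h : IsSparse a N u)
    (hi : i < u.length) (hN : ¬ N ∣ i + 1) : u[i]? = some a := by
  rw [List.getElem?_eq_getElem hi]
  by_contra hne
  exact hN (h i _ (List.getElem?_eq_getElem hi) fun he => hne (by rw [he]))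

theorem IsSparse.mul_of_coprime {a : A} {M N : ℕ} {u : List A} (hM : IsSparse a M u)
    (hN : IsSparse a N u) (h : M.Coprime N) : IsSparse a (M * N) u :=
  fun i b hb hba => h.mul_dvd_of_dvd_of_dvd (hM i b hb hba) (hN i b hb hba)

theorem not_dvd_one_of_two_le {N : ℕ} (hN : 2 ≤ N) : ¬ N ∣ 1 := fun h => by
  have := Nat.le_of_dvd one_pos h
  omega

theorem cons_desub_mem (hQ : ∀ q ∈ Q, Nat.Prime q) {x a : A} (hxa : x ≠ a) {N : ℕ} (hN : 0 < N)
    {u : List A} (hs : IsSparse a N u) (h : x :: u ∈ FQ A Q) : x :: desub N u ∈ FQ A Q := by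
  have hQ2 : ∀ q ∈ Q, 2 ≤ q := fun q hq => (hQ q hq).two_le
  induction hn : u.length using Nat.strong_induction_on generalizing u N with
  | _ n ih =>
  subst hn
  by_cases hu : u = []
  · subst hu
    simpa [desub] using singleton_mem_FQ x
  have hpos := List.length_pos_iff.2 hu
  obtain rfl | hN2 : N = 1 ∨ 2 ≤ N := by omega
  · rwa [desub_one]
  obtain ⟨a', M, hM, h'⟩ := aligned_or_shifted hQ2 h hu
  have hM2 := hQ2 M hM
  have hM0 : 0 < M := by omega
  by_cases ha : a' = a
  · subst ha
    obtain ⟨hsM, hd⟩ | ⟨rfl, -⟩ := h'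
    swap
    · exact absurd rfl hxa
    have hlt : (desub M u).length < u.length := by
      rw [length_desub]
      exact Nat.div_lt_self hpos hM2
    by_cases hMN : M ∣ N
    · obtain ⟨K, rfl⟩ := hMN
      have hK : 0 < K := Nat.pos_of_mul_pos_left hN
      rw [mul_comm] at hs ⊢
      rw [← desub_desub hK hM0]
      exact ih _ hlt hK ((isSparse_mul_iff hM0).1 hs).2 hd rfl
    · have hmul := hsM.mul_of_coprime hs (((hQ M hM).coprime_iff_not_dvd).2 hMN)
      have h1 := ((isSparse_mul_iff hN).1 hmul).2
      rw [mul_comm] at hmul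
      have h2 := ih _ hlt hN ((isSparse_mul_iff hM0).1 hmul).2 hd rfl
      rw [desub_desub hN hM0, mul_comm, ← desub_desub hM0 hN] at h2
      exact cons_mem_of_cons_desub_mem hQ2 hM h1 h2
  · obtain ⟨hsM, -⟩ | ⟨rfl, k, -, -, hsM, -⟩ := h'
    · have h0 := hs.getElem?_eq_of_not_dvd hpos (not_dvd_one_of_two_le hN2)
      exact absurd (hsM 0 a h0 (Ne.symm ha)) (not_dvd_one_of_two_le hM2)
    have hrep : desub N u = List.replicate (desub N u).length x := by
      refine List.eq_replicate_iff.2 ⟨rfl, fun b hb => ?_⟩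
      obtain ⟨j, hj⟩ := List.mem_iff_getElem?.1 hb
      rw [getElem?_desub hN] at hj
      obtain ⟨hj', -⟩ := List.getElem?_eq_some_iff.1 hj
      have h0 : N ≤ (j + 1) * N := Nat.le_mul_of_pos_left _ (Nat.succ_pos _)
      have heq : (j + 1) * N - 1 = (j + 1) * N - 2 + 1 := by omega
      have hprev := hs.getElem?_eq_of_not_dvd (i := (j + 1) * N - 2) (by omega) (by
        intro hd
        refine not_dvd_one_of_two_le hN2 ((Nat.dvd_add_right hd).1 ?_)
        rw [← heq, Nat.sub_add_cancel (by omega)]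
        exact dvd_mul_left _ _)
      rw [heq] at hj
      exact (hsM.eq_or_eq_of_replicate_append hM2 hprev hj).resolve_left (Ne.symm hxa)
    rw [hrep, ← List.replicate_succ]
    exact replicate_mem_FQ hM hM2 x _

theorem cons_self_mem_of_alternating (hQ : ∀ q ∈ Q, 2 ≤ q) {a c : A} (hca : c ≠ a) {v : List A}
    (hcv : c :: a :: v ∈ FQ A Q) {q : ℕ} (hq : q ∈ Q)
    (hmax : ∀ M ∈ Q, ¬ IsSparse a M (a :: v))
    (hadj : ∀ i x y, (a :: v)[i]? = some x → (a :: v)[i + 1]? = some y → x = a ∨ y = a) :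
    a :: a :: v ∈ FQ A Q := by
  obtain ⟨a', M, hM, ⟨hs, -⟩ | ⟨rfl, k, -, -, hs, -⟩⟩ :=
    aligned_or_shifted hQ hcv (List.cons_ne_nil _ _)
  · by_cases ha : a' = a
    · exact absurd (ha ▸ hs) (hmax M hM)
    · exact absurd (hs 0 a rfl (Ne.symm ha)) (not_dvd_one_of_two_le (hQ M hM))
  have hac := Ne.symm hca
  have h0 := hs.dvd_of_replicate_append (i := 0) rfl hac
  match v with
  | [] =>
    refine absurd ?_ (hmax q hq)
    rintro (_ | i) b hb hba <;> simp at hb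
    exact absurd hb.symm hba
  | [w] =>
    obtain rfl := (hs.eq_or_eq_of_replicate_append (hQ M hM) (i := 0) rfl rfl).resolve_left hac
    refine mem_FQ_of_isInfix (phi_mem_FQ (pair_mem_FQ hq (hQ q hq) a w) a hq) ?_
    obtain ⟨q, rfl⟩ := Nat.exists_eq_add_of_le' (hQ q hq)
    refine ⟨List.replicate (q + 1) a ++ List.replicate q a, [], ?_⟩
    have h : a :: List.replicate (q + 1) a = List.replicate q a ++ [a, a] := by
      rw [← List.replicate_succ, List.replicate_succ', List.replicate_succ']
      simp
    rw [phi_cons, phi_cons, ← List.cons_append, show q + 2 - 1 = q + 1 from rfl, h]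
    simp only [List.append_assoc, List.cons_append, List.nil_append, List.append_nil, phi,
      List.flatMap_nil]
  | w :: w' :: v =>
    obtain rfl := (hs.eq_or_eq_of_replicate_append (hQ M hM) (i := 0) rfl rfl).resolve_left hac
    obtain rfl := (hadj 1 _ _ rfl rfl).resolve_left hca
    have h2 := hs.dvd_of_replicate_append (i := 2) rfl hac
    obtain rfl : M = 2 := by
      have : M ∣ 2 := (Nat.dvd_add_right h0).1 (by convert h2 using 1)
      have := Nat.le_of_dvd two_pos this
      have := hQ M hM
      omega
    refine absurd ?_ (hmax 2 hM)
    intro i b hb hba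
    by_contra hi
    obtain _ | i := i
    · exact hba (by simpa using hb.symm)
    obtain ⟨e, he⟩ : ∃ e, (w' :: w :: w' :: v)[i]? = some e :=
      ⟨_, List.getElem?_eq_getElem (by
        have := (List.getElem?_eq_some_iff.1 hb).1
        omega)⟩
    obtain rfl := (hadj i e b he hb).resolve_right hba
    have := hs.dvd_of_replicate_append he hac
    omega

theorem cons_self_desub_mem (hQ : ∀ q ∈ Q, Nat.Prime q) {a c : A} (hca : c ≠ a) {N : ℕ}
    (hN : 0 < N) {u : List A} (hs : IsSparse a N u)
    (hmax : ∀ M ∈ Q, ¬ IsSparse a M (desub N u)) (hau : a :: u ∈ FQ A Q)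
    (hcu : c :: u ∈ FQ A Q) : a :: desub N u ∈ FQ A Q := by
  have hQ2 : ∀ q ∈ Q, 2 ≤ q := fun q hq => (hQ q hq).two_le
  induction hn : N using Nat.strong_induction_on generalizing u N with
  | _ n ih =>
  subst hn
  by_cases hu : u = []
  · subst hu
    simpa [desub] using singleton_mem_FQ a
  have hpos := List.length_pos_iff.2 hu
  obtain rfl | hN2 : N = 1 ∨ 2 ≤ N := by omega
  · rwa [desub_one]
  have hcv := cons_desub_mem hQ hca hN hs hcu
  obtain ⟨a', M, hM, h'⟩ := aligned_or_shifted hQ2 hau hu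
  have hM2 := hQ2 M hM
  have hM0 : 0 < M := by omega
  have ha : a' = a := by
    by_contra ha
    obtain ⟨hsM, -⟩ | ⟨rfl, -⟩ := h'
    · have h0 := hs.getElem?_eq_of_not_dvd hpos (not_dvd_one_of_two_le hN2)
      exact absurd (hsM 0 a h0 (Ne.symm ha)) (not_dvd_one_of_two_le hM2)
    · exact ha rfl
  subst ha
  obtain ⟨hsM, hd⟩ | ⟨-, k, hk, hkM, hsM, hd⟩ := h'
  · by_cases hMN : M ∣ N
    · obtain ⟨K, rfl⟩ := hMN
      have hK : 0 < K := Nat.pos_of_mul_pos_left hN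
      rw [mul_comm M K] at *
      rw [← desub_desub hK hM0] at hmax ⊢
      exact ih K (by nlinarith) hK ((isSparse_mul_iff hM0).1 hs).2 hmax hd
        (cons_desub_mem hQ hca hM0 hsM hcu) rfl
    · have hmul := hsM.mul_of_coprime hs (((hQ M hM).coprime_iff_not_dvd).2 hMN)
      exact absurd ((isSparse_mul_iff hN).1 hmul).2 (hmax M hM)
  have hkd : ¬ M ∣ k := fun h => by
    have := Nat.le_of_dvd hk h
    omega
  have hdvd : ∀ i b, (desub N u)[i]? = some b → b ≠ a' → M ∣ k + (i + 1) * N := by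
    intro i b hb hba
    rw [getElem?_desub hN] at hb
    have := hsM.dvd_of_replicate_append hb hba
    have h0 : 0 < (i + 1) * N := Nat.mul_pos (Nat.succ_pos _) hN
    rwa [add_assoc, Nat.sub_add_cancel h0] at this
  have hadj : ∀ i x y, (desub N u)[i]? = some x → (desub N u)[i + 1]? = some y →
      x = a' ∨ y = a' := by
    intro i x y hx hy
    by_contra! hne
    have h1 := hdvd i x hx hne.1
    have h2 := hdvd _ y hy hne.2
    rw [add_mul (i + 1), one_mul, ← add_assoc] at h2
    have h3 : M ∣ N := (Nat.dvd_add_right h1).1 h2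
    exact hkd ((Nat.dvd_add_left (h3.mul_left _)).1 h1)
  obtain ⟨z, v, hv⟩ : ∃ z v, desub N u = z :: v := by
    cases hv : desub N u with
    | nil =>
      refine absurd ?_ (hmax M hM)
      rw [hv]
      intro i b hb
      simp at hb
    | cons z v => exact ⟨z, v, rfl⟩
  by_cases hz : z = a'
  · subst hz
    rw [hv] at hcv hmax hadj ⊢
    exact cons_self_mem_of_alternating hQ2 hca hcv hM hmax hadj
  have hz0 : u[N - 1]? = some z := by
    have := getElem?_desub hN u 0
    rw [hv] at this
    simpa using this.symm
  have hkN : M ∣ k + N := by simpa using hdvd 0 z (by rw [hv]; rfl) hz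
  have hMN : ¬ M ∣ N := fun h => hkd ((Nat.dvd_add_left h).1 hkN)
  have hv' : v = desub N (u.drop N) := by
    have := desub_drop hN u 1
    rw [hv, one_mul] at this
    simpa using this.symm
  have hsv : IsSparse a' M v := by
    intro i b hb hba
    have := hdvd (i + 1) b (by rw [hv]; simpa using hb) hba
    rw [add_mul (i + 1), one_mul, add_comm _ N, ← add_assoc, Nat.dvd_add_right hkN] at this
    exact ((hQ M hM).dvd_mul.1 this).resolve_right hMN
  have hsN : IsSparse a' N (u.drop N) := by simpa using hs.drop 1
  have hsM' : IsSparse a' M (u.drop N) := by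
    intro i b hb hba
    rw [List.getElem?_drop] at hb
    have := hsM.dvd_of_replicate_append hb hba
    rwa [← add_assoc, add_assoc _ i, Nat.dvd_add_right hkN] at this
  have hzM : z :: desub M (u.drop N) ∈ FQ A Q := by
    obtain ⟨j, hj⟩ := hkN
    obtain _ | j := j
    · simp at hj
      omega
    have hj0 : (desub M (List.replicate k a' ++ u))[j]? = some z := by
      rw [getElem?_desub hM0, mul_comm, ← hj, List.getElem?_append_right (by simp; omega)]
      rw [← hz0]
      congr 1
      simp
      omega
    obtain ⟨h1, h2⟩ := List.getElem?_eq_some_iff.1 hj0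
    have := List.drop_eq_getElem_cons h1
    rw [h2, ← desub_drop hM0 _ (j + 1), mul_comm, ← hj, List.drop_append] at this
    have hdr : List.drop (k + N) (List.replicate k a') = [] := by simp
    rw [hdr, List.length_replicate, Nat.add_sub_cancel_left, List.nil_append] at this
    rw [← this]
    exact mem_FQ_of_isInfix hd (List.drop_suffix _ _).isInfix
  have hmul := hsN.mul_of_coprime hsM' ((((hQ M hM).coprime_iff_not_dvd).2 hMN).symm)
  have := cons_desub_mem hQ hz hN ((isSparse_mul_iff hM0).1 hmul).2 hzM
  rw [desub_desub hN hM0, mul_comm, ← desub_desub hM0 hN, ← hv'] at this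
  rw [hv]
  exact cons_cons_mem_of_cons_desub_mem hQ2 hM hsv this

theorem exists_maximal_isSparse (hQ : ∀ q ∈ Q, Nat.Prime q) {a : A} {u : List A}
    (hu : ∃ b ∈ u, b ≠ a) :
    ∃ N, 0 < N ∧ (∀ p, Nat.Prime p → p ∣ N → p ∈ Q) ∧ IsSparse a N u ∧
      (∀ M ∈ Q, ¬ IsSparse a M (desub N u)) ∧
      ∀ x, x :: desub N u ∈ FQ A Q → x :: u ∈ FQ A Q := by
  have hQ2 : ∀ q ∈ Q, 2 ≤ q := fun q hq => (hQ q hq).two_le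
  induction hn : u.length using Nat.strong_induction_on generalizing u with
  | _ n ih =>
  subst hn
  by_cases h : ∃ M ∈ Q, IsSparse a M u
  · obtain ⟨M, hM, hs⟩ := h
    have hM0 := (hQ M hM).pos
    have hpos : 0 < u.length := List.length_pos_of_mem hu.choose_spec.1
    obtain ⟨N, hN, hp, hsN, hmax, hx⟩ := ih (desub M u).length (by
      rw [length_desub]
      exact Nat.div_lt_self hpos (hQ2 M hM)) (exists_ne_desub hM0 hs hu) rfl
    rw [desub_desub hN hM0] at hmax hx
    refine ⟨N * M, Nat.mul_pos hN hM0, fun p hpp hpd => ?_, (isSparse_mul_iff hM0).2 ⟨hs, hsN⟩,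
      hmax, fun x h => cons_mem_of_cons_desub_mem hQ2 hM hs (hx x h)⟩
    obtain h | h := hpp.dvd_mul.1 hpd
    · exact hp p hpp h
    · rwa [(Nat.prime_dvd_prime_iff_eq hpp (hQ M hM)).1 h]
  · push Not at h
    exact ⟨1, one_pos, fun p hpp hpd => absurd (Nat.dvd_one.1 hpd) hpp.ne_one, .one a u,
      by rwa [desub_one], fun x hx => by rwa [desub_one] at hx⟩

theorem isSparse_two_of_shifted {a b : A} (hab : a ≠ b) {M M' k k' : ℕ} (hM : 2 ≤ M)
    (hM' : 2 ≤ M') {u : List A} (hlen : 3 ≤ u.length) (h0 : u[0]? = some a)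
    (hs : IsSparse a M (List.replicate k a ++ u))
    (hs' : IsSparse b M' (List.replicate k' b ++ u)) : M' = 2 ∧ IsSparse a 2 u := by
  obtain ⟨y, h1⟩ : ∃ y, u[1]? = some y := ⟨_, List.getElem?_eq_getElem (by omega)⟩
  obtain ⟨z, h2⟩ : ∃ z, u[2]? = some z := ⟨_, List.getElem?_eq_getElem (by omega)⟩
  obtain rfl := (hs'.eq_or_eq_of_replicate_append hM' h0 h1).resolve_left hab
  obtain rfl := (hs.eq_or_eq_of_replicate_append hM h1 h2).resolve_left hab.symm
  have hd0 := hs'.dvd_of_replicate_append h0 hab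
  have hd2 := hs'.dvd_of_replicate_append h2 hab
  have h22 : M' ∣ 2 := (Nat.dvd_add_right hd0).1 (by convert hd2 using 1)
  obtain rfl : M' = 2 := by
    have := Nat.le_of_dvd two_pos h22
    omega
  refine ⟨rfl, fun i b hb hba => ?_⟩
  by_contra hi
  obtain _ | i := i
  · exact hba (by simpa [h0] using hb.symm)
  obtain ⟨e, he⟩ : ∃ e, u[i]? = some e := ⟨_, List.getElem?_eq_getElem (by
    have := (List.getElem?_eq_some_iff.1 hb).1
    omega)⟩
  obtain rfl := (hs.eq_or_eq_of_replicate_append hM he hb).resolve_right hba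
  have := hs'.dvd_of_replicate_append he hab
  omega

theorem exists_isSparse_of_two_extensions (hQ : ∀ q ∈ Q, 2 ≤ q) {x y : A} (hxy : x ≠ y)
    {u : List A} (hlen : 3 ≤ u.length) (hx : x :: u ∈ FQ A Q) (hy : y :: u ∈ FQ A Q) :
    ∃ a, ∃ M ∈ Q, IsSparse a M u ∧ ∃ c, c ≠ a ∧ c :: u ∈ FQ A Q := by
  have hu : u ≠ [] := by
    rintro rfl
    simp at hlen
  have hex : ∀ a, ∃ c, c ≠ a ∧ c :: u ∈ FQ A Q := fun a => by
    by_cases h : x = a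
    · exact ⟨y, h ▸ hxy.symm, hy⟩
    · exact ⟨x, h, hx⟩
  obtain ⟨a, M, hM, ⟨hs, -⟩ | ⟨rfl, k, -, -, hs, -⟩⟩ := aligned_or_shifted hQ hx hu
  · exact ⟨a, M, hM, hs, hex a⟩
  obtain ⟨b, M', hM', ⟨hs', -⟩ | ⟨rfl, k', -, -, hs', -⟩⟩ := aligned_or_shifted hQ hy hu
  · exact ⟨b, M', hM', hs', hex b⟩
  have h0 : u[0]? = some u[0] := List.getElem?_eq_getElem (by omega)
  have h1 : u[1]? = some u[1] := List.getElem?_eq_getElem (by omega)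
  have : u[0] = x ∨ u[0] = y := by
    obtain h | h := hs.eq_or_eq_of_replicate_append (hQ M hM) h0 h1
    · exact .inl h
    obtain h' | h' := hs'.eq_or_eq_of_replicate_append (hQ M' hM') h0 h1
    · exact .inr h'
    exact absurd (h.symm.trans h') hxy
  obtain h | h := this <;> rw [h] at h0
  · obtain ⟨rfl, h2⟩ := isSparse_two_of_shifted hxy (hQ M hM) (hQ M' hM') hlen h0 hs hs'
    exact ⟨x, 2, hM', h2, hex x⟩
  · obtain ⟨rfl, h2⟩ := isSparse_two_of_shifted hxy.symm (hQ M' hM') (hQ M hM) hlen h0 hs' hs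
    exact ⟨y, 2, hM, h2, hex y⟩

end Special

/-- **Lemma 1.** A special word `u` of `F(Σ,Q)` of length `n ≥ 3`
is either `a^n` for a letter `a`, or `u = φ_{a,N}(v)·a^{N'}` for a letter `a`,
an integer `N ≥ 2` all of whose prime divisors lie in `Q`, some `0 ≤ N' < N` and
some `v ∈ F(Σ,Q)` containing a letter `b ≠ a` and with `L(v) = L(u)`. -/
theorem special_word_structure {A : Type*} [Fintype A]
    (hd : 2 ≤ Fintype.card A) (Q : Finset ℕ) (hQ : ∀ q ∈ Q, Nat.Prime q)
    (u : List A) (hu : IsSpecial A Q u) (hlen : 3 ≤ u.length) :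
    (∃ a : A, u = List.replicate u.length a) ∨
    (∃ (a : A) (N N' : ℕ) (v : List A),
      2 ≤ N ∧ (∀ p : ℕ, Nat.Prime p → p ∣ N → p ∈ Q) ∧ N' < N ∧
      v ∈ FQ A Q ∧ u = phi a N v ++ List.replicate N' a ∧
      (∃ b ∈ v, b ≠ a) ∧ Lext A Q v = Lext A Q u) := by
  obtain ⟨huF, hcard⟩ := hu
  have hQ2 : ∀ q ∈ Q, 2 ≤ q := fun q hq => (hQ q hq).two_le
  obtain ⟨q, hq⟩ := exists_mem_of_mem_FQ huF (by omega)
  obtain ⟨x, hx⟩ := exists_cons_mem_FQ hq (hQ2 q hq) huF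
  obtain ⟨y, hy, hyx⟩ : ∃ y, y :: u ∈ FQ A Q ∧ y ≠ x := by
    by_contra! h
    exact hcard (Set.ncard_eq_one.2 ⟨x, Set.eq_singleton_iff_unique_mem.2 ⟨hx, h⟩⟩)
  obtain ⟨a, M, hM, hs, c, hca, hcu⟩ := exists_isSparse_of_two_extensions hQ2 hyx hlen hy hx
  by_cases hconst : ∀ b ∈ u, b = a
  · exact .inl ⟨a, List.eq_replicate_iff.2 ⟨rfl, hconst⟩⟩
  push Not at hconst
  obtain ⟨N, hN, hp, hsN, hmax, hext⟩ := exists_maximal_isSparse hQ hconst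
  have hcv := cons_desub_mem hQ hca hN hsN hcu
  refine .inr ⟨a, N, u.length % N, desub N u, ?_, hp, Nat.mod_lt _ hN,
    mem_FQ_of_isInfix hcv (List.suffix_cons _ _).isInfix, (phi_desub hN hsN).symm,
    exists_ne_desub hN hsN hconst, Set.ext fun e => ⟨hext e, fun he => ?_⟩⟩
  · by_contra hN1
    obtain rfl : N = 1 := by omega
    rw [desub_one] at hmax
    exact hmax M hM hs
  · by_cases hea : e = a
    · subst hea
      exact cons_self_desub_mem hQ hca hN hsN hmax he hcu
    · exact cons_desub_mem hQ hea hN hsN he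
end

section
/- (Wiener–Pitt Tauberian theorem.) Let g be a summable function on (0,+∞) whose Mellin transform ∫_0^∞ g(t)·t^{ix} dt is non-zero for every real x. Let f be a real-valued bounded function which slowly decreases, in the sense that whenever y > x → +∞ with y/x → 1 one has liminf (f(y) − f(x)) ≥ 0. If (1/x)·∫_0^∞ f(t)·g(t/x) dt → l·∫_0^∞ g(t) dt as x → +∞, then f(t) → l as t → +∞. -/
open Filter MeasureTheory

open scoped Topology Convolution FourierTransform SchwartzMap ContDiff

open ContinuousLinearMap (mul)

/-- A measurable complex-valued function on the line that is everywhere bounded by a constant. -/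
def IsBddMeas (F : ℝ → ℂ) : Prop :=
  AEStronglyMeasurable F volume ∧ ∃ M : ℝ, ∀ x, ‖F x‖ ≤ M

theorem IsBddMeas.integrable_convolution_integrand {h F : ℝ → ℂ} (hh : Integrable h)
    (hF : IsBddMeas F) (x : ℝ) : Integrable (fun t => h t * F (x - t)) := by
  obtain ⟨hm, M, hM⟩ := hF
  refine hh.mul_bdd (c := M) ?_ (ae_of_all _ fun t => hM _)
  exact hm.comp_quasiMeasurePreserving (quasiMeasurePreserving_sub_left_of_right_invariant volume x)

theorem norm_convolution_le {h F : ℝ → ℂ} (hh : Integrable h) {M : ℝ} (hM : ∀ x, ‖F x‖ ≤ M)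
    (x : ℝ) : ‖(h ⋆[mul ℂ ℂ] F) x‖ ≤ (∫ t, ‖h t‖) * M := by
  rw [convolution_mul, ← integral_mul_const]
  refine norm_integral_le_of_norm_le (hh.norm.mul_const M) (ae_of_all _ fun t => ?_)
  rw [norm_mul]
  exact mul_le_mul_of_nonneg_left (hM _) (norm_nonneg _)

theorem IsBddMeas.convolution {h F : ℝ → ℂ} (hh : Integrable h) (hF : IsBddMeas F) :
    IsBddMeas (h ⋆[mul ℂ ℂ] F) := by
  obtain ⟨hm, M, hM⟩ := hF
  refine ⟨?_, _, norm_convolution_le hh hM⟩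
  exact (hh.aestronglyMeasurable.convolution_integrand
    (mul ℂ ℂ) hm).integral_prod_right'

theorem convolution_sub_left {h k F : ℝ → ℂ} (hh : Integrable h) (hk : Integrable k)
    (hF : IsBddMeas F) (x : ℝ) :
    ((fun t => h t - k t) ⋆[mul ℂ ℂ] F) x = (h ⋆[mul ℂ ℂ] F) x - (k ⋆[mul ℂ ℂ] F) x := by
  simp only [convolution_mul, sub_mul]
  exact integral_sub (hF.integrable_convolution_integrand hh x)
    (hF.integrable_convolution_integrand hk x)

theorem convolution_assoc_of_isBddMeas {f g F : ℝ → ℂ} (hf : Integrable f) (hg : Integrable g)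
    (hF : IsBddMeas F) : (f ⋆[mul ℂ ℂ] g) ⋆[mul ℂ ℂ] F = f ⋆[mul ℂ ℂ] (g ⋆[mul ℂ ℂ] F) := by
  ext x
  have hFn : IsBddMeas (fun x => (‖F x‖ : ℂ)) :=
    ⟨(Complex.continuous_ofReal.comp_aestronglyMeasurable hF.1.norm), by
      simpa using hF.2⟩
  have hgn : Integrable (fun x => (‖g x‖ : ℂ)) := hg.norm.ofReal
  have hfn : Integrable (fun x => (‖f x‖ : ℂ)) := hf.norm.ofReal
  refine convolution_assoc _ _ _ _ (fun x y z => ?_) hf.aestronglyMeasurable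
    hg.aestronglyMeasurable hF.1 (hf.ae_convolution_exists _ hg) (ae_of_all _ fun x => ?_) ?_
  · simp [mul_assoc]
  · have := (hFn.integrable_convolution_integrand hgn x).re
    simpa [ConvolutionExistsAt] using this
  · have := ((hFn.convolution hgn).integrable_convolution_integrand hfn x).re
    simp only [ConvolutionExistsAt]
    convert! this using 2 with t
    simp only [convolution_def, ContinuousLinearMap.mul_apply', ← Complex.ofReal_mul]
    rw [integral_complex_ofReal]
    simp

theorem convolution_mul_comm (f g : ℝ → ℂ) : f ⋆[mul ℂ ℂ] g = g ⋆[mul ℂ ℂ] f := by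
  have : (mul ℂ ℂ).flip = ContinuousLinearMap.mul ℂ ℂ := by
    ext; simp
  rw [← convolution_flip, this]

theorem tendsto_convolution_zero {k G : ℝ → ℂ} (hk : Integrable k) (hG : IsBddMeas G)
    (h0 : Tendsto G atTop (𝓝 0)) : Tendsto (k ⋆[mul ℂ ℂ] G) atTop (𝓝 0) := by
  obtain ⟨M, hM⟩ := hG.2
  have := tendsto_integral_filter_of_dominated_convergence (μ := volume) (l := atTop)
    (F := fun x t => k t * G (x - t)) (f := fun _ => 0) (fun t => ‖k t‖ * M)
    (Eventually.of_forall fun x => (hG.integrable_convolution_integrand hk x).1)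
    (Eventually.of_forall fun x => ae_of_all _ fun t => by
      rw [norm_mul]; exact mul_le_mul_of_nonneg_left (hM _) (norm_nonneg _))
    (hk.norm.mul_const M)
    (ae_of_all _ fun t => by
      simpa [← sub_eq_add_neg] using
        (h0.comp (tendsto_atTop_add_const_right _ (-t) tendsto_id)).const_mul (k t))
  rw [integral_zero] at this
  exact this

theorem eventually_norm_convolution_le {k G : ℝ → ℂ} (hk : Integrable k) (hG : IsBddMeas G)
    {a ε : ℝ} (ha : ∀ᶠ x in atTop, ‖G x‖ ≤ a) (ha0 : 0 ≤ a) (hε : 0 < ε) :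
    ∀ᶠ x in atTop, ‖(k ⋆[mul ℂ ℂ] G) x‖ ≤ (∫ t, ‖k t‖) * a + ε := by
  obtain ⟨T, hT⟩ := eventually_atTop.1 ha
  obtain ⟨M, hM⟩ := hG.2
  set G₁ : ℝ → ℂ := (Set.Ici T).indicator G
  set G₂ : ℝ → ℂ := (Set.Iio T).indicator G
  have hG₁ : ∀ x, ‖G₁ x‖ ≤ a := fun x => by
    by_cases hx : x ∈ Set.Ici T
    · simpa [G₁, hx] using hT x hx
    · simpa [G₁, Set.indicator_of_notMem hx] using ha0
  have hb₁ : IsBddMeas G₁ := ⟨hG.1.indicator measurableSet_Ici, a, hG₁⟩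
  have hb₂ : IsBddMeas G₂ := ⟨hG.1.indicator measurableSet_Iio, M, fun x =>
    (norm_indicator_le_norm_self _ _).trans (hM x)⟩
  have h₂ : Tendsto G₂ atTop (𝓝 0) := by
    refine tendsto_const_nhds.congr' ?_
    filter_upwards [eventually_ge_atTop T] with x hx
    exact (Set.indicator_of_notMem (by simpa using hx) _).symm
  have hsum : ∀ x, (k ⋆[mul ℂ ℂ] G) x = (k ⋆[mul ℂ ℂ] G₁) x + (k ⋆[mul ℂ ℂ] G₂) x := fun x => by
    simp only [convolution_mul]
    rw [← integral_add (hb₁.integrable_convolution_integrand hk x)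
      (hb₂.integrable_convolution_integrand hk x)]
    congr 1 with t
    rw [← mul_add]
    by_cases hx : T ≤ x - t
    · simp [G₁, G₂, hx]
    · simp [G₁, G₂, hx, lt_of_not_ge hx]
  have := (tendsto_convolution_zero hk hb₂ h₂).norm.eventually_lt_const (by simpa using hε)
  filter_upwards [this] with x hx
  rw [hsum]
  exact (norm_add_le _ _).trans (add_le_add (norm_convolution_le hk hG₁ x) hx.le)

/-- If `W` reproduces `H` and `K ⋆ W` is close to a nonzero multiple of `W`, then
`K ⋆ H → 0` forces `H → 0`. -/
theorem tendsto_zero_of_convolution_reproducing {K W H : ℝ → ℂ} {c : ℂ} (hK : Integrable K)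
    (hW : Integrable W) (hH : IsBddMeas H) (hc : c ≠ 0)
    (hsmall : ∫ x, ‖(K ⋆[mul ℂ ℂ] W) x - c * W x‖ ≤ ‖c‖ / 2)
    (hWH : W ⋆[mul ℂ ℂ] H = H) (hKH : Tendsto (K ⋆[mul ℂ ℂ] H) atTop (𝓝 0)) : Tendsto H atTop (𝓝 0) := by
  have hKW : Integrable (K ⋆[mul ℂ ℂ] W) := hK.integrable_convolution _ hW
  have hcW : Integrable (fun x => c * W x) := hW.const_mul c
  set u : ℝ → ℂ := fun x => (K ⋆[mul ℂ ℂ] W) x - c * W x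
  have hu : Integrable u := hKW.sub hcW
  have hc' : 0 < ‖c‖ := norm_pos_iff.2 hc
  have hWKH : Tendsto ((K ⋆[mul ℂ ℂ] W) ⋆[mul ℂ ℂ] H) atTop (𝓝 0) := by
    rw [convolution_mul_comm K W, convolution_assoc_of_isBddMeas hW hK hH]
    exact tendsto_convolution_zero hW (hH.convolution hK) hKH
  have key : ∀ x, c * H x = ((K ⋆[mul ℂ ℂ] W) ⋆[mul ℂ ℂ] H) x - (u ⋆[mul ℂ ℂ] H) x := fun x => by
    rw [convolution_sub_left hKW hcW hH]
    have : ((fun x => c * W x) ⋆[mul ℂ ℂ] H) x = c * (W ⋆[mul ℂ ℂ] H) x := by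
      simp only [convolution_mul, mul_assoc, integral_const_mul]
    rw [this, hWH]; ring
  have step : ∀ a : ℝ, 0 < a → (∀ᶠ x in atTop, ‖H x‖ ≤ a) →
      ∀ᶠ x in atTop, ‖H x‖ ≤ a * (3 / 4) := fun a ha hev => by
    have hε : 0 < ‖c‖ * a / 8 := by positivity
    filter_upwards [eventually_norm_convolution_le hu hH hev ha.le hε,
      hWKH.norm.eventually_lt_const (u := ‖c‖ * a / 8) (by simpa using hε)] with x hx1 hx2
    have h1 : ‖c‖ * ‖H x‖ ≤ ‖((K ⋆[mul ℂ ℂ] W) ⋆[mul ℂ ℂ] H) x‖ + ‖(u ⋆[mul ℂ ℂ] H) x‖ := by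
      rw [← norm_mul, key]; exact norm_sub_le _ _
    have h2 : (∫ t, ‖u t‖) * a ≤ ‖c‖ / 2 * a := mul_le_mul_of_nonneg_right hsmall ha.le
    have h3 : ‖c‖ * ‖H x‖ ≤ ‖c‖ * (a * (3 / 4)) := by linarith
    exact le_of_mul_le_mul_left h3 hc'
  obtain ⟨M, hM⟩ := hH.2
  have hpow : ∀ n : ℕ, ∀ᶠ x in atTop, ‖H x‖ ≤ (|M| + 1) * (3 / 4) ^ n := fun n => by
    induction n with
    | zero =>
      refine Eventually.of_forall fun x => ?_
      have := hM x
      have := le_abs_self M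
      simp only [pow_zero, mul_one]; linarith
    | succ n ih =>
      rw [pow_succ, ← mul_assoc]
      exact step _ (by positivity) ih
  have hlim : Tendsto (fun n : ℕ => (|M| + 1) * (3 / 4 : ℝ) ^ n) atTop (𝓝 0) := by
    simpa using (tendsto_pow_atTop_nhds_zero_of_lt_one (r := (3 / 4 : ℝ)) (by norm_num)
      (by norm_num)).const_mul (|M| + 1)
  rw [Metric.tendsto_nhds]
  intro ε hε
  obtain ⟨n, hn⟩ := (hlim.eventually_lt_const hε).exists
  filter_upwards [hpow n] with x hx
  rw [dist_zero_right]
  exact hx.trans_lt hn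

theorem continuous_integral_norm_sub_translate {k : ℝ → ℂ} (hk : Integrable k) :
    Continuous (fun s : ℝ => ∫ x, ‖k (x - s) - k x‖) := by
  have hm : MemLp k 1 volume := memLp_one_iff_integrable.2 hk
  have : Fact ((1 : ENNReal) ≠ ⊤) := ⟨ENNReal.one_ne_top⟩
  have hc : Continuous (fun s : ℝ => ‖(DomAddAct.mk (-s) +ᵥ hm.toLp k) - hm.toLp k‖) := by
    have : Continuous (fun s : ℝ => DomAddAct.mk (-s)) :=
      DomAddAct.continuous_mk.comp continuous_neg
    fun_prop
  convert hc using 2 with s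
  rw [DomAddAct.mk_vadd_toLp, ← MemLp.toLp_sub, Lp.norm_toLp, eLpNorm_one_eq_lintegral_enorm,
    integral_norm_eq_lintegral_enorm]
  · congr 2
    ext x
    simp [sub_eq_add_neg, add_comm]
  · exact ((hk.comp_sub_right s).sub hk).1

theorem integral_norm_sub_translate_le {k : ℝ → ℂ} (hk : Integrable k) (s : ℝ) :
    ∫ x, ‖k (x - s) - k x‖ ≤ 2 * ∫ x, ‖k x‖ := by
  have h1 : ∫ x, ‖k (x - s) - k x‖ ≤ ∫ x, (‖k (x - s)‖ + ‖k x‖) :=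
    integral_mono ((hk.comp_sub_right s).sub hk).norm ((hk.comp_sub_right s).norm.add hk.norm)
      fun x => norm_sub_le _ _
  rw [integral_add (hk.comp_sub_right s).norm hk.norm,
    integral_sub_right_eq_self (fun x => ‖k x‖)] at h1
  linarith

/-- Minkowski's inequality for `K ⋆ V - (∫ K) V` in terms of the `L¹` modulus of continuity
of `V`. -/
theorem integral_norm_convolution_sub_le {K V : ℝ → ℂ} (hK : Integrable K) (hV : Integrable V) :
    ∫ x, ‖(K ⋆[mul ℂ ℂ] V) x - (∫ t, K t) * V x‖ ≤ ∫ t, ‖K t‖ * ∫ x, ‖V (x - t) - V x‖ := by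
  have hint : Integrable (fun p : ℝ × ℝ => K p.2 * (V (p.1 - p.2) - V p.1)) := by
    have h1 := hK.convolution_integrand (mul ℂ ℂ) hV
    have h2 : Integrable (fun p : ℝ × ℝ => V p.1 * K p.2) (volume.prod volume) := hV.mul_prod hK
    refine (h1.sub h2).congr (ae_of_all _ fun p => ?_)
    simp [mul_sub, mul_comm]
  have hswap : ∫ x, ∫ t, ‖K t * (V (x - t) - V x)‖ = ∫ t, ∫ x, ‖K t * (V (x - t) - V x)‖ :=
    integral_integral_swap hint.norm
  have hR : ∫ t, ‖K t‖ * ∫ x, ‖V (x - t) - V x‖ = ∫ x, ∫ t, ‖K t * (V (x - t) - V x)‖ := by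
    rw [hswap]
    simp only [norm_mul, integral_const_mul]
  rw [hR]
  have hae : ∀ᵐ x, ‖(K ⋆[mul ℂ ℂ] V) x - (∫ t, K t) * V x‖ ≤ ∫ t, ‖K t * (V (x - t) - V x)‖ := by
    filter_upwards [hK.ae_convolution_exists (mul ℂ ℂ) hV] with x hx
    have : (K ⋆[mul ℂ ℂ] V) x - (∫ t, K t) * V x = ∫ t, K t * (V (x - t) - V x) := by
      rw [convolution_mul, ← integral_mul_const, ← integral_sub (by exact hx) (hK.mul_const _)]
      simp only [mul_sub]
    rw [this]
    exact norm_integral_le_integral_norm _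
  exact integral_mono_ae
    ((hK.integrable_convolution (mul ℂ ℂ) hV).sub (hV.const_mul _)).norm
    hint.norm.integral_prod_left hae

theorem tendsto_integral_norm_mul_modulus {K V : ℝ → ℂ} (hK : Integrable K) (hV : Integrable V) :
    Tendsto (fun r : ℝ => ∫ t, ‖K t‖ * ∫ x, ‖V (x - r * t) - V x‖) (𝓝 0) (𝓝 0) := by
  have hc := continuous_integral_norm_sub_translate hV
  have := tendsto_integral_filter_of_dominated_convergence (μ := volume) (l := 𝓝 (0 : ℝ))
    (F := fun r t => ‖K t‖ * ∫ x, ‖V (x - r * t) - V x‖) (f := fun _ => 0)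
    (fun t => ‖K t‖ * (2 * ∫ x, ‖V x‖))
    (Eventually.of_forall fun r => hK.norm.1.mul
      (hc.comp (continuous_const.mul continuous_id)).aestronglyMeasurable)
    (Eventually.of_forall fun r => ae_of_all _ fun t => by
      rw [norm_mul, norm_norm, Real.norm_of_nonneg (integral_nonneg fun _ => norm_nonneg _)]
      exact mul_le_mul_of_nonneg_left (integral_norm_sub_translate_le hV _) (norm_nonneg _))
    (hK.norm.mul_const _)
    (ae_of_all _ fun t => by
      have h : Continuous (fun r : ℝ => ‖K t‖ * ∫ x, ‖V (x - r * t) - V x‖) :=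
        continuous_const.mul (hc.comp (continuous_id.mul continuous_const))
      simpa using h.tendsto 0)
  rwa [integral_zero] at this

theorem integral_norm_sub_translate_scale (V : ℝ → ℂ) {r : ℝ} (hr : 0 < r) (t : ℝ) :
    ∫ x, ‖(r : ℂ) * V (r * (x - t)) - r * V (r * x)‖ = ∫ x, ‖V (x - r * t) - V x‖ := by
  have h := Measure.integral_comp_mul_left (fun x => ‖V (x - r * t) - V x‖) r
  simp only [← mul_sub, norm_mul, Complex.norm_real, Real.norm_of_nonneg hr.le]
  rw [integral_const_mul]
  simp only [mul_sub]
  rw [h, abs_of_pos (inv_pos.2 hr), smul_eq_mul, mul_inv_cancel_left₀ hr.ne']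

theorem tendsto_convolution_zero_of_approx {k F : ℝ → ℂ} (hk : Integrable k) (hF : IsBddMeas F)
    (happrox : ∀ ε > 0, ∃ h : ℝ → ℂ, Integrable h ∧ ∫ x, ‖h x - k x‖ ≤ ε ∧
      Tendsto (h ⋆[mul ℂ ℂ] F) atTop (𝓝 0)) : Tendsto (k ⋆[mul ℂ ℂ] F) atTop (𝓝 0) := by
  obtain ⟨M, hM⟩ := hF.2
  rw [Metric.tendsto_nhds]
  intro ε hε
  have hM' : 0 < |M| + 1 := by positivity
  obtain ⟨h, hh, hle, hlim⟩ := happrox (ε / 2 / (|M| + 1)) (by positivity)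
  filter_upwards [(Metric.tendsto_nhds.1 hlim) (ε / 2) (half_pos hε)] with x hx
  rw [dist_zero_right] at hx ⊢
  have h1 := convolution_sub_left hh hk hF x
  have h2 := norm_convolution_le (hh.sub hk) (F := F) (M := |M| + 1)
    (fun x => (hM x).trans (by linarith [le_abs_self M])) x
  have h3 : (∫ x, ‖h x - k x‖) * (|M| + 1) ≤ ε / 2 := by
    rwa [← le_div_iff₀ hM']
  have h4 : (k ⋆[mul ℂ ℂ] F) x = (h ⋆[mul ℂ ℂ] F) x - ((fun t => h t - k t) ⋆[mul ℂ ℂ] F) x := by rw [h1]; ring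
  rw [h4]
  calc _ ≤ ‖(h ⋆[mul ℂ ℂ] F) x‖ + ‖((fun t => h t - k t) ⋆[mul ℂ ℂ] F) x‖ := norm_sub_le _ _
    _ < ε := by
      have : ‖((fun t => h t - k t) ⋆[mul ℂ ℂ] F) x‖ ≤ ε / 2 := h2.trans h3
      linarith

/-- There is a Schwartz function `V` of integral one whose dilates and modulations all have
smooth compactly supported Fourier transforms equal to one on large balls. -/
theorem exists_schwartz_fourier_plateau : ∃ V : 𝓢(ℝ, ℂ), ∫ x, V x = 1 ∧
    ∀ (ξ₀ r : ℝ), 0 < r → ∃ w : 𝓢(ℝ, ℂ), HasCompactSupport w ∧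
      (∀ ξ ∈ Metric.ball ξ₀ r, w ξ = 1) ∧
      ∀ x : ℝ, (𝓕⁻ w) x = ((𝐞 (ξ₀ * x) : Circle) : ℂ) * (r * V (r * x)) := by
  let χ : ContDiffBump (0 : ℝ) := ⟨1, 2, one_pos, one_lt_two⟩
  have hsm : ContDiff ℝ ∞ (fun x => (χ x : ℂ)) :=
    Complex.ofRealCLM.contDiff.comp χ.contDiff
  have hcs : HasCompactSupport (fun x => (χ x : ℂ)) :=
    χ.hasCompactSupport.comp_left (g := ((↑) : ℝ → ℂ)) Complex.ofReal_zero
  let X : 𝓢(ℝ, ℂ) := hcs.toSchwartzMap hsm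
  have hX : ∀ x, X x = χ x := fun x => rfl
  refine ⟨𝓕⁻ X, ?_, fun ξ₀ r hr => ?_⟩
  · have h1 : 𝓕 (𝓕⁻ X) = X := FourierTransform.fourier_fourierInv_eq X
    have h2 : (𝓕 (𝓕⁻ X)) 0 = X 0 := by rw [h1]
    rw [SchwartzMap.fourier_coe, Real.fourier_eq] at h2
    simp only [inner_zero_right, neg_zero, AddChar.map_zero_eq_one, one_smul] at h2
    rw [h2, hX, χ.one_of_mem_closedBall (by simp [χ.rIn_pos.le])]
    simp
  · have hsm' : ContDiff ℝ ∞ (fun x => (χ (r⁻¹ * (x - ξ₀)) : ℂ)) :=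
      hsm.comp (contDiff_const.mul (contDiff_id.sub contDiff_const))
    let e : ℝ ≃ₜ ℝ := (Homeomorph.subRight ξ₀).trans (Homeomorph.mulLeft₀ r⁻¹ (inv_ne_zero hr.ne'))
    have hcs' : HasCompactSupport (fun x => (χ (r⁻¹ * (x - ξ₀)) : ℂ)) := hcs.comp_homeomorph e
    refine ⟨hcs'.toSchwartzMap hsm', hcs', fun ξ hξ => ?_, fun x => ?_⟩
    · have : χ (r⁻¹ * (ξ - ξ₀)) = 1 := by
        apply χ.one_of_mem_closedBall
        rw [mem_closedBall_zero_iff, norm_mul, norm_inv, Real.norm_of_nonneg hr.le]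
        rw [mem_ball_iff_norm] at hξ
        rw [inv_mul_le_iff₀ hr]
        simpa [χ] using hξ.le
      change ((χ (r⁻¹ * (ξ - ξ₀)) : ℝ) : ℂ) = 1
      rw [this]; simp
    · rw [SchwartzMap.fourierInv_coe, SchwartzMap.fourierInv_coe, Real.fourierInv_eq,
        Real.fourierInv_eq]
      change ∫ v, 𝐞 (inner ℝ v x) • (χ (r⁻¹ * (v - ξ₀)) : ℂ) = _ * (_ * ∫ v, 𝐞 (inner ℝ v (r * x)) • (χ v : ℂ))
      have h1 := integral_sub_right_eq_self
        (fun v => 𝐞 (inner ℝ (v + ξ₀) x) • (χ (r⁻¹ * v) : ℂ)) (μ := volume) ξ₀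
      simp only [sub_add_cancel] at h1
      have h2 := Measure.integral_comp_mul_left
        (fun v => 𝐞 (inner ℝ (r * v + ξ₀) x) • (χ v : ℂ)) r⁻¹
      simp only [mul_inv_cancel_left₀ hr.ne', inv_inv, abs_of_pos hr] at h2
      rw [h1, h2, Complex.real_smul, mul_left_comm]
      congr 1
      rw [← integral_const_mul]
      congr 1 with v
      simp only [Circle.smul_def, smul_eq_mul, ← mul_assoc, ← Circle.coe_mul,
        ← AddChar.map_add_eq_mul]
      congr 4
      simp
      ring

/-- Wiener's local lemma: near a frequency where the Fourier transform of `K` does not vanish,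
`K ⋆ F → 0` forces `h ⋆ F → 0` for band-limited Schwartz functions `h`. -/
theorem exists_radius_tendsto_fourierInv_convolution {K F : ℝ → ℂ} (hK : Integrable K)
    (hF : IsBddMeas F) (hKF : Tendsto (K ⋆[mul ℂ ℂ] F) atTop (𝓝 0)) {ξ₀ : ℝ} (hξ : 𝓕 K ξ₀ ≠ 0) :
    ∃ r > 0, ∀ φ : 𝓢(ℝ, ℂ), Function.support φ ⊆ Metric.ball ξ₀ r →
      Tendsto ((𝓕⁻ φ : 𝓢(ℝ, ℂ)) ⋆[mul ℂ ℂ] F) atTop (𝓝 0) := by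
  obtain ⟨V, -, hV⟩ := exists_schwartz_fourier_plateau
  have hlim := tendsto_integral_norm_mul_modulus hK V.integrable
  obtain ⟨r, hr2, hr⟩ : ∃ r : ℝ,
      (∫ t, ‖K t‖ * ∫ x, ‖V (x - r * t) - V x‖) < ‖𝓕 K ξ₀‖ / 2 ∧ 0 < r :=
    (((hlim.mono_left (nhdsWithin_le_nhds (s := Set.Ioi (0 : ℝ)))).eventually_lt_const
      (half_pos (norm_pos_iff.2 hξ))).and self_mem_nhdsWithin).exists
  obtain ⟨w, -, hw1, hw⟩ := hV ξ₀ r hr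
  refine ⟨r, hr, fun φ hφ => ?_⟩
  set h : 𝓢(ℝ, ℂ) := 𝓕⁻ φ
  set W : 𝓢(ℝ, ℂ) := 𝓕⁻ w
  have hh := h.integrable (μ := volume)
  have hW := W.integrable (μ := volume)
  have hWh : (W : ℝ → ℂ) ⋆[mul ℂ ℂ] h = h := by
    ext x
    rw [← SchwartzMap.convolution_apply]
    have : SchwartzMap.convolution (mul ℂ ℂ) W h = h := by
      have h1 : 𝓕 (SchwartzMap.convolution (mul ℂ ℂ) W h) = 𝓕 h := by
        rw [SchwartzMap.fourier_convolution]
        ext ξ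
        simp only [W, h, FourierTransform.fourier_fourierInv_eq, SchwartzMap.pairing_apply_apply,
          ContinuousLinearMap.mul_apply']
        by_cases hξ : ξ ∈ Function.support φ
        · rw [hw1 ξ (hφ hξ), one_mul]
        · rw [Function.notMem_support.1 hξ, mul_zero]
      rw [← FourierTransform.fourierInv_fourier_eq (E := 𝓢(ℝ, ℂ)) (F := 𝓢(ℝ, ℂ))
        (SchwartzMap.convolution _ W h), h1,
        FourierTransform.fourierInv_fourier_eq]
    rw [this]
  refine tendsto_zero_of_convolution_reproducing hK hW (hF.convolution hh) hξ ?_ ?_ ?_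
  · set K' : ℝ → ℂ := fun t => ((𝐞 (-(ξ₀ * t)) : Circle) : ℂ) * K t
    set V' : ℝ → ℂ := fun x => r * V (r * x)
    have hK' : Integrable K' := by
      refine hK.bdd_mul (c := 1) ?_ (ae_of_all _ fun t => (Circle.norm_coe _).le)
      exact Continuous.aestronglyMeasurable (by fun_prop)
    have hV' : Integrable V' := (V.integrable.comp_mul_left' hr.ne').const_mul _
    have hc : 𝓕 K ξ₀ = ∫ t, K' t := by
      rw [Real.fourier_eq]
      simp only [K', Circle.smul_def, smul_eq_mul]
      congr 1
    have hpt : ∀ x, ‖(K ⋆[mul ℂ ℂ] W) x - 𝓕 K ξ₀ * W x‖ = ‖(K' ⋆[mul ℂ ℂ] V') x - (∫ t, K' t) * V' x‖ := by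
      intro x
      have : (K ⋆[mul ℂ ℂ] W) x - 𝓕 K ξ₀ * W x =
          ((𝐞 (ξ₀ * x) : Circle) : ℂ) * ((K' ⋆[mul ℂ ℂ] V') x - (∫ t, K' t) * V' x) := by
        rw [mul_sub, hw, hc]
        congr 1
        · simp only [convolution_mul]
          rw [← integral_const_mul]
          congr 1 with t
          rw [hw, show ξ₀ * (x - t) = ξ₀ * x + -(ξ₀ * t) by ring, AddChar.map_add_eq_mul,
            Circle.coe_mul]
          simp only [K', V']
          ring
        · simp only [V']; ring
      rw [this, norm_mul, Circle.norm_coe, one_mul]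
    simp only [hpt]
    refine (integral_norm_convolution_sub_le hK' hV').trans ?_
    simp only [V', integral_norm_sub_translate_scale V hr]
    simpa only [K', norm_mul, Circle.norm_coe, one_mul] using hr2.le
  · rw [← convolution_assoc_of_isBddMeas hW hh hF, hWh]
  · rw [← convolution_assoc_of_isBddMeas hK hh hF, convolution_mul_comm K,
      convolution_assoc_of_isBddMeas hh hK hF]
    exact tendsto_convolution_zero hh (hF.convolution hK) hKF

theorem tendsto_fourierInv_convolution {K F : ℝ → ℂ} (hK : Integrable K)
    (hF : IsBddMeas F) (hKF : Tendsto (K ⋆[mul ℂ ℂ] F) atTop (𝓝 0)) (hne : ∀ ξ, 𝓕 K ξ ≠ 0)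
    (φ : 𝓢(ℝ, ℂ)) (hφ : HasCompactSupport φ) :
    Tendsto ((𝓕⁻ φ : 𝓢(ℝ, ℂ)) ⋆[mul ℂ ℂ] F) atTop (𝓝 0) := by
  choose r hr hloc using fun ξ => exists_radius_tendsto_fourierInv_convolution hK hF hKF (hne ξ)
  obtain ⟨ρ, hρ⟩ := SmoothPartitionOfUnity.exists_isSubordinate (modelWithCornersSelf ℝ ℝ)
    (isClosed_tsupport φ) (fun ξ => Metric.ball ξ (r ξ)) (fun ξ => Metric.isOpen_ball)
    (fun ξ _ => Set.mem_iUnion.2 ⟨ξ, Metric.mem_ball_self (hr ξ)⟩)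
  have hfin := ρ.locallyFinite.finite_nonempty_inter_compact hφ
  have hsm : ∀ i, ContDiff ℝ ∞ (fun x => (ρ i x : ℂ) * φ x) := fun i =>
    (Complex.ofRealCLM.contDiff.comp (ρ i).contMDiff.contDiff).mul (φ.smooth ⊤)
  have hcs : ∀ i, HasCompactSupport (fun x => (ρ i x : ℂ) * φ x) := fun i => hφ.mul_left
  let ψ : ℝ → 𝓢(ℝ, ℂ) := fun i => (hcs i).toSchwartzMap (hsm i)
  have hψ : ∀ i x, ψ i x = (ρ i x : ℂ) * φ x := fun i x => rfl
  have hsum : φ = ∑ i ∈ hfin.toFinset, ψ i := by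
    ext x
    rw [sum_apply]
    simp only [hψ, ← Finset.sum_mul]
    by_cases hx : x ∈ tsupport φ
    · have h1 := ρ.sum_eq_one hx
      rw [finsum_eq_sum_of_support_subset (s := hfin.toFinset)] at h1
      · rw [← Complex.ofReal_sum, h1, Complex.ofReal_one, one_mul]
      · intro i hi
        simp only [Set.Finite.coe_toFinset, Set.mem_ofPred_eq]
        exact ⟨x, hi, hx⟩
    · rw [image_eq_zero_of_notMem_tsupport hx, mul_zero]
  have hconv : ((𝓕⁻ φ : 𝓢(ℝ, ℂ)) : ℝ → ℂ) ⋆[mul ℂ ℂ] F =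
      fun x => ∑ i ∈ hfin.toFinset, (((𝓕⁻ (ψ i) : 𝓢(ℝ, ℂ)) : ℝ → ℂ) ⋆[mul ℂ ℂ] F) x := by
    have h1 : (𝓕⁻ φ : 𝓢(ℝ, ℂ)) = ∑ i ∈ hfin.toFinset, 𝓕⁻ (ψ i) := by
      conv_lhs => rw [hsum]
      exact map_sum (FourierTransform.fourierInvCLM ℂ 𝓢(ℝ, ℂ)) _ _
    ext x
    simp only [convolution_mul]
    rw [← integral_finsetSum _ fun i _ =>
      hF.integrable_convolution_integrand (𝓕⁻ (ψ i) : 𝓢(ℝ, ℂ)).integrable x, h1]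
    simp only [sum_apply, Finset.sum_mul]
  rw [hconv]
  rw [← Finset.sum_const_zero (s := hfin.toFinset) (ι := ℝ)]
  refine tendsto_finsetSum _ fun i _ => hloc i (ψ i) ?_
  refine (Function.support_subset_iff'.2 fun x hx => ?_ : _ ⊆ tsupport (ρ i)).trans (hρ i)
  rw [hψ, image_eq_zero_of_notMem_tsupport hx, Complex.ofReal_zero, zero_mul]

/-- **Wiener's Tauberian theorem**: if the Fourier transform of `K` has no zeros, then
`K ⋆ F → 0` implies `k ⋆ F → 0` for all integrable `k`. -/
theorem wiener_tauberian {K F : ℝ → ℂ} (hK : Integrable K)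
    (hF : IsBddMeas F) (hKF : Tendsto (K ⋆[mul ℂ ℂ] F) atTop (𝓝 0)) (hne : ∀ ξ, 𝓕 K ξ ≠ 0)
    {k : ℝ → ℂ} (hk : Integrable k) : Tendsto (k ⋆[mul ℂ ℂ] F) atTop (𝓝 0) := by
  refine tendsto_convolution_zero_of_approx hk hF fun ε hε => ?_
  obtain ⟨V, hV1, hV⟩ := exists_schwartz_fourier_plateau
  have hlim := tendsto_integral_norm_mul_modulus (V.integrable (μ := volume)) hk
  obtain ⟨r, hr2, hr⟩ : ∃ r : ℝ,
      (∫ t, ‖V t‖ * ∫ x, ‖k (x - r * t) - k x‖) < ε ∧ 0 < r :=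
    (((hlim.mono_left (nhdsWithin_le_nhds (s := Set.Ioi (0 : ℝ)))).eventually_lt_const
      hε).and self_mem_nhdsWithin).exists
  obtain ⟨w, hwc, -, hw⟩ := hV 0 r⁻¹ (inv_pos.2 hr)
  set W : 𝓢(ℝ, ℂ) := 𝓕⁻ w
  have hW := W.integrable (μ := volume)
  have hWx : ∀ x, W x = (r⁻¹ : ℝ) * V (r⁻¹ * x) := fun x => by simp [hw]
  have hr' : |(r⁻¹)⁻¹| = r := by rw [inv_inv, abs_of_pos hr]
  have hW1 : ∫ x, W x = 1 := by
    simp only [hWx]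
    rw [integral_const_mul, Measure.integral_comp_mul_left (fun x => V x), hV1, hr']
    simp [hr.ne']
  refine ⟨W ⋆[mul ℂ ℂ] k, hW.integrable_convolution _ hk, ?_, ?_⟩
  · have h1 := integral_norm_convolution_sub_le hW hk
    simp only [hW1, one_mul] at h1
    refine h1.trans (le_trans (le_of_eq ?_) hr2.le)
    have h2 := Measure.integral_comp_mul_left
      (fun t => ‖V t‖ * ∫ x, ‖k (x - r * t) - k x‖) r⁻¹
    rw [hr', smul_eq_mul] at h2
    simp only [mul_inv_cancel_left₀ hr.ne'] at h2
    simp only [hWx, norm_mul, mul_assoc, integral_const_mul, h2, Complex.norm_real,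
      Real.norm_of_nonneg (inv_pos.2 hr).le]
    rw [inv_mul_cancel_left₀ hr.ne']
  · rw [convolution_mul_comm _ k, convolution_assoc_of_isBddMeas hk hW hF]
    exact tendsto_convolution_zero hk (hF.convolution hW)
      (tendsto_fourierInv_convolution hK hF hKF hne w hwc)

theorem image_exp_neg_univ : (fun u : ℝ => Real.exp (-u)) '' Set.univ = Set.Ioi 0 := by
  ext x
  simp only [Set.image_univ, Set.mem_range, Set.mem_Ioi]
  exact ⟨fun ⟨u, hu⟩ => hu ▸ Real.exp_pos _, fun hx => ⟨-Real.log x, by simp [Real.exp_log hx]⟩⟩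

theorem hasDerivWithinAt_exp_neg (u : ℝ) :
    HasDerivWithinAt (fun u : ℝ => Real.exp (-u)) (-Real.exp (-u)) Set.univ u := by
  exact (by simpa using (hasDerivAt_neg u).exp :
    HasDerivAt (fun u : ℝ => Real.exp (-u)) (-Real.exp (-u)) u).hasDerivWithinAt

theorem injOn_exp_neg : Set.InjOn (fun u : ℝ => Real.exp (-u)) Set.univ := fun x _ y _ h => by
  simpa using h

theorem integral_Ioi_eq_integral_exp_neg (G : ℝ → ℝ) :
    ∫ t in Set.Ioi (0 : ℝ), G t = ∫ u, Real.exp (-u) * G (Real.exp (-u)) := by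
  rw [← image_exp_neg_univ, integral_image_eq_integral_abs_deriv_smul MeasurableSet.univ
    (fun u _ => hasDerivWithinAt_exp_neg u) injOn_exp_neg, Measure.restrict_univ]
  simp

theorem IntegrableOn.integrable_exp_neg {G : ℝ → ℝ} (hG : IntegrableOn G (Set.Ioi 0)) :
    Integrable (fun u => Real.exp (-u) * G (Real.exp (-u))) := by
  rw [← image_exp_neg_univ, integrableOn_image_iff_integrableOn_abs_deriv_smul MeasurableSet.univ
    (fun u _ => hasDerivWithinAt_exp_neg u) injOn_exp_neg, integrableOn_univ] at hG
  simpa using hG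

theorem fourier_exp_neg_eq_mellin (g : ℝ → ℝ) (ξ : ℝ) :
    𝓕 (fun u : ℝ => ((Real.exp (-u) * g (Real.exp (-u)) : ℝ) : ℂ)) ξ =
      ∫ t in Set.Ioi (0 : ℝ),
        (g t : ℂ) * (t : ℂ) ^ (Complex.I * ((2 * Real.pi * ξ : ℝ) : ℂ)) := by
  have h := mellin_eq_fourier (fun t => (g t : ℂ)) (s := 1 + Complex.I * (2 * Real.pi * ξ : ℝ))
  have h1 : (1 + Complex.I * ((2 * Real.pi * ξ : ℝ) : ℂ)).re = 1 := by simp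
  have h2 : (1 + Complex.I * ((2 * Real.pi * ξ : ℝ) : ℂ)).im = 2 * Real.pi * ξ := by simp
  rw [h1, h2, mul_div_cancel_left₀ _ (by positivity), mellin] at h
  simp only [add_sub_cancel_left, smul_eq_mul, neg_one_mul, Complex.real_smul] at h
  simp only [Complex.ofReal_mul (Real.exp _)]
  rw [← h]
  simp only [mul_comm]

theorem integral_exp_neg_mul_sub_const {g f : ℝ → ℝ} {M : ℝ} (l : ℝ)
    (hg : IntegrableOn g (Set.Ioi 0)) (hf_meas : Measurable f) (hM : ∀ t, |f t| ≤ M) (y : ℝ) :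
    ∫ u, Real.exp (-u) * g (Real.exp (-u)) * (f (Real.exp (y - u)) - l) =
      (1 / Real.exp y) * (∫ t in Set.Ioi (0 : ℝ), f t * g (t / Real.exp y)) -
        l * ∫ t in Set.Ioi (0 : ℝ), g t := by
  have hy := Real.exp_pos y
  have h1 := integral_Ioi_eq_integral_exp_neg (fun t => g t * (f (Real.exp y * t) - l))
  simp only [← Real.exp_add, ← sub_eq_add_neg, ← mul_assoc] at h1
  rw [← h1]
  simp only [mul_sub]
  have hint : IntegrableOn (fun t => g t * f (Real.exp y * t)) (Set.Ioi 0) :=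
    hg.mul_bdd (c := M) (hf_meas.comp (measurable_const_mul _)).aestronglyMeasurable
      (ae_of_all _ fun t => hM _)
  rw [integral_sub hint (hg.mul_const l), integral_mul_const, mul_comm l]
  congr 1
  have h2 := integral_comp_mul_left_Ioi (fun t => f t * g (t / Real.exp y)) 0 hy
  simp only [mul_zero, smul_eq_mul, mul_div_cancel_left₀ _ hy.ne'] at h2
  rw [one_div, ← h2]
  simp only [mul_comm]

/-- Pitt's step: a bounded slowly decreasing function whose averages over short intervals all
tend to zero tends to zero. -/
theorem tendsto_zero_of_tendsto_intervalIntegral {H : ℝ → ℝ}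
    (hint : ∀ a b, IntervalIntegrable H volume a b)
    (hslow : ∀ ε > 0, ∃ δ > 0, ∃ Y, ∀ x y, Y ≤ x → x ≤ y → y ≤ x + δ → H x - ε ≤ H y)
    (havg : ∀ δ > 0, Tendsto (fun y => ∫ t in (y - δ)..y, H t) atTop (𝓝 0)) :
    Tendsto H atTop (𝓝 0) := by
  rw [Metric.tendsto_nhds]
  intro ε hε
  obtain ⟨δ, hδ, Y, hY⟩ := hslow (ε / 2) (half_pos hε)
  have hsmall : ∀ᶠ y in atTop, |∫ t in (y - δ)..y, H t| < δ * (ε / 2) := by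
    simpa using (Metric.tendsto_nhds.1 (havg δ hδ)) (δ * (ε / 2)) (by positivity)
  filter_upwards [hsmall, (tendsto_atTop_add_const_right _ δ tendsto_id).eventually hsmall,
    eventually_ge_atTop (Y + δ)] with y h1 h2 h3
  simp only [id, add_sub_cancel_right] at h2
  rw [Real.dist_eq, sub_zero, abs_lt]
  have hl : ∫ t in (y - δ)..y, H t ≤ ∫ t in (y - δ)..y, (H y + ε / 2) :=
    intervalIntegral.integral_mono_on (by linarith) (hint _ _) intervalIntegrable_const
      fun t ht => by linarith [hY t y (by linarith [ht.1]) ht.2 (by linarith [ht.1])]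
  have hu : ∫ t in y..(y + δ), (H y - ε / 2) ≤ ∫ t in y..(y + δ), H t :=
    intervalIntegral.integral_mono_on (by linarith) intervalIntegrable_const (hint _ _)
      fun t ht => hY y t (by linarith) ht.1 ht.2
  rw [intervalIntegral.integral_const, smul_eq_mul] at hl hu
  rw [sub_sub_cancel] at hl
  rw [add_sub_cancel_left] at hu
  rw [abs_lt] at h1 h2
  constructor
  · have : δ * (-(ε / 2)) < δ * (H y + ε / 2) := by linarith
    linarith [lt_of_mul_lt_mul_left this hδ.le]
  · have : δ * (H y - ε / 2) < δ * (ε / 2) := by linarith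
    linarith [lt_of_mul_lt_mul_left this hδ.le]

theorem tendsto_intervalIntegral_of_tendsto_indicator_convolution {H : ℝ → ℝ} {δ : ℝ}
    (hδ : 0 ≤ δ) (h : Tendsto (((Set.Ioc 0 δ).indicator fun _ => (1 : ℂ)) ⋆[mul ℂ ℂ] fun s => (H s : ℂ))
      atTop (𝓝 0)) :
    Tendsto (fun y => ∫ t in (y - δ)..y, H t) atTop (𝓝 0) := by
  have heq : ∀ y, (((Set.Ioc 0 δ).indicator fun _ => (1 : ℂ)) ⋆[mul ℂ ℂ] fun s => (H s : ℂ)) y =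
      ((∫ t in (y - δ)..y, H t : ℝ) : ℂ) := fun y => by
    have h1 := intervalIntegral.integral_comp_sub_left (fun t => H t) y (a := 0) (b := δ)
    rw [sub_zero] at h1
    rw [← h1, intervalIntegral.integral_of_le hδ, ← integral_complex_ofReal,
      ← integral_indicator measurableSet_Ioc, convolution_mul]
    congr 1 with t
    by_cases ht : t ∈ Set.Ioc 0 δ
    · simp only [Set.indicator_of_mem ht, one_mul]
    · simp only [Set.indicator_of_notMem ht, zero_mul]
  rw [tendsto_zero_iff_norm_tendsto_zero] at h ⊢
  simpa only [heq, Complex.norm_real] using h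

/-- **Wiener–Pitt Tauberian theorem.** Let `g` be summable on
`(0,∞)` with nowhere-vanishing Mellin transform `∫_0^∞ g(t) t^{ix} dt`, and let
`f` be a real-valued, bounded, slowly decreasing function. If
`(1/x) ∫_0^∞ f(t) g(t/x) dt → l ∫_0^∞ g(t) dt` as `x → +∞`, then `f(t) → l` as
`t → +∞`. -/
theorem wiener_pitt (g f : ℝ → ℝ) (l : ℝ)
    (hg : IntegrableOn g (Set.Ioi 0))
    (hMellin : ∀ x : ℝ,
      (∫ t in Set.Ioi (0 : ℝ), (g t : ℂ) * (t : ℂ) ^ (Complex.I * (x : ℂ))) ≠ 0)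
    (hf_meas : Measurable f)
    (hf_bdd : ∃ M : ℝ, ∀ t : ℝ, |f t| ≤ M)
    (hf_slow : ∀ ε : ℝ, 0 < ε → ∃ δ : ℝ, 0 < δ ∧ ∃ X : ℝ, ∀ x y : ℝ,
      X ≤ x → x < y → y / x ≤ 1 + δ → -ε ≤ f y - f x)
    (hconv : Tendsto (fun x : ℝ => (1 / x) * ∫ t in Set.Ioi (0 : ℝ), f t * g (t / x))
      atTop (nhds (l * ∫ t in Set.Ioi (0 : ℝ), g t))) :
    Tendsto f atTop (nhds l) := by
  obtain ⟨M, hM⟩ := hf_bdd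
  set H : ℝ → ℝ := fun s => f (Real.exp s) - l
  set K : ℝ → ℂ := fun u => ((Real.exp (-u) * g (Real.exp (-u)) : ℝ) : ℂ)
  have hHmeas : Measurable H := (hf_meas.comp Real.measurable_exp).sub_const l
  have hHbd : ∀ s, ‖H s‖ ≤ M + |l| := fun s =>
    (abs_sub _ _).trans (add_le_add (hM _) le_rfl)
  have hF : IsBddMeas (fun s => (H s : ℂ)) :=
    ⟨(Complex.measurable_ofReal.comp hHmeas).aestronglyMeasurable, M + |l|, fun s => by
      rw [Complex.norm_real]; exact hHbd s⟩
  have hK : Integrable K := (IntegrableOn.integrable_exp_neg hg).ofReal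
  have hKne : ∀ ξ, 𝓕 K ξ ≠ 0 := fun ξ => by
    rw [fourier_exp_neg_eq_mellin]; exact hMellin _
  have hKF : Tendsto (K ⋆[mul ℂ ℂ] fun s => (H s : ℂ)) atTop (𝓝 0) := by
    have heq : ∀ y, (K ⋆[mul ℂ ℂ] fun s => (H s : ℂ)) y = (((1 / Real.exp y) *
        (∫ t in Set.Ioi (0 : ℝ), f t * g (t / Real.exp y)) -
          l * ∫ t in Set.Ioi (0 : ℝ), g t : ℝ) : ℂ) := fun y => by
      rw [← integral_exp_neg_mul_sub_const l hg hf_meas hM, ← integral_complex_ofReal,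
        convolution_mul]
      simp only [K, H, Complex.ofReal_mul]
    have h1 := (hconv.comp Real.tendsto_exp_atTop).sub_const (l * ∫ t in Set.Ioi (0 : ℝ), g t)
    rw [sub_self] at h1
    rw [funext heq, ← Complex.ofReal_zero]
    exact (Complex.continuous_ofReal.tendsto 0).comp h1
  have hH : Tendsto H atTop (𝓝 0) := by
    refine tendsto_zero_of_tendsto_intervalIntegral (fun a b => ?_) (fun ε hε => ?_)
      fun δ hδ => ?_
    · exact (intervalIntegrable_const (c := M + |l|)).mono_fun hHmeas.aestronglyMeasurable
        (ae_of_all _ fun s => (hHbd s).trans (le_abs_self _))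
    · obtain ⟨δ, hδ, X, hX⟩ := hf_slow ε hε
      refine ⟨Real.log (1 + δ), Real.log_pos (by linarith), Real.log (max X 1),
        fun x y hx hxy hy => ?_⟩
      rcases hxy.eq_or_lt with rfl | hxy
      · linarith
      have hX1 : 0 < max X 1 := lt_max_of_lt_right one_pos
      have h1 : X ≤ Real.exp x := (le_max_left _ _).trans ((Real.log_le_iff_le_exp hX1).1 hx)
      have h2 : Real.exp y / Real.exp x ≤ 1 + δ := by
        rw [← Real.exp_sub, ← Real.le_log_iff_exp_le (by linarith)]
        linarith
      have := hX _ _ h1 (Real.exp_lt_exp.2 hxy) h2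
      simp only [H]
      linarith
    · refine tendsto_intervalIntegral_of_tendsto_indicator_convolution hδ.le
        (wiener_tauberian hK hF hKF hKne ?_)
      exact (integrable_indicator_iff measurableSet_Ioc).2
        (integrableOn_const (by simp))
  have h1 := (hH.comp Real.tendsto_log_atTop).add_const l
  rw [zero_add] at h1
  refine h1.congr' ?_
  filter_upwards [eventually_gt_atTop 0] with t ht
  simp [H, Real.exp_log ht]
end

section
/- Let c_1,…,c_l be real numbers and m_1,…,m_l real numbers with m_i > 1 for all i, and set F(z) = Σ_{i=1}^{l} c_i·m_i^{−z}. Suppose that the equation F(α) = 1 has a unique positive solution α = α_0, that F(α_0 + ix) ≠ 1 for every real x ≠ 0, and that F'(α_0) ≠ 0. Let s : [0,∞) → ℝ be a non-decreasing function with s(x) = s(⌊x⌋) for all x ≥ 0, satisfying s(x) = Σ_{i=1}^{l} c_i·s(x/m_i) for all x ≥ N_0 (for some N_0 > 0) and s(x) = O(x^{α_0}) as x → +∞. Then the quotient s(x)/x^{α_0} tends to a (finite) limit as x → ∞. -/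
open Filter Asymptotics

section Tauberian

open MeasureTheory FourierTransform Topology
open scoped ContDiff

theorem integral_mul_integral_mul_sub {g k w : ℝ → ℂ} {M : ℝ} (hg : Measurable g)
    (hgM : ∀ x, ‖g x‖ ≤ M) (hk : Integrable k) (hw : Integrable w) (t : ℝ) :
    ∫ u, g (t - u) * ∫ v, k v * w (u - v) = ∫ u, w u * ∫ v, k v * g (t - u - v) := by
  have h₁ : Integrable (fun p : ℝ × ℝ => g (t - p.1) * (k p.2 * w (p.1 - p.2)))
      (volume.prod volume) :=
    (hk.convolution_integrand (ContinuousLinearMap.mul ℝ ℂ) hw).bdd_mul (c := M)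
      (hg.comp (by fun_prop)).aestronglyMeasurable (ae_of_all _ fun p => hgM _)
  have h₂ : Integrable (fun p : ℝ × ℝ => g (t - p.2 - p.1) * (k p.1 * w p.2))
      (volume.prod volume) :=
    (hk.mul_prod hw).bdd_mul (c := M) (hg.comp (by fun_prop)).aestronglyMeasurable
      (ae_of_all _ fun p => hgM _)
  calc ∫ u, g (t - u) * ∫ v, k v * w (u - v)
      = ∫ u, ∫ v, g (t - u) * (k v * w (u - v)) := by simp_rw [integral_const_mul]
    _ = ∫ v, ∫ u, g (t - u) * (k v * w (u - v)) := integral_integral_swap h₁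
    _ = ∫ v, ∫ u, g (t - u - v) * (k v * w u) := by
        congr 1 with v
        rw [← integral_add_right_eq_self _ v]
        congr 1 with u
        rw [add_sub_cancel_right, sub_sub]
    _ = ∫ u, ∫ v, g (t - u - v) * (k v * w u) := integral_integral_swap h₂
    _ = ∫ u, w u * ∫ v, k v * g (t - u - v) := by
        simp_rw [← integral_const_mul]
        congr! 4
        ring

theorem integral_mul_fourierInv_sub {k ψ : ℝ → ℂ} (hk : Integrable k) (hψ : Integrable ψ)
    (u : ℝ) : ∫ v, k v * 𝓕⁻ ψ (u - v) = 𝓕⁻ (fun x => 𝓕 k x * ψ x) u := by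
  have hG : Integrable (fun x : ℝ => Complex.exp (2 * Real.pi * (x * u) * Complex.I) * ψ x) :=
    hψ.bdd_mul (c := 1) (by fun_prop) (ae_of_all _ fun x => by simp [Complex.norm_exp])
  have := VectorFourier.integral_fourierIntegral_smul_eq_flip (L := innerₗ ℝ) (μ := volume)
    (ν := volume) Real.continuous_fourierChar continuous_inner hk hG
  simp only [smul_eq_mul] at this
  have e : 𝓕⁻ (fun x => 𝓕 k x * ψ x) u =
      ∫ x, 𝓕 k x * (Complex.exp (2 * Real.pi * (x * u) * Complex.I) * ψ x) := by
    rw [Real.fourierInv_eq']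
    congr 1 with x
    simp
    ring_nf
  rw [e]
  refine Eq.trans ?_ this.symm
  congr 1 with v
  congr 1
  rw [Real.fourierInv_eq']
  simp only [VectorFourier.fourierIntegral]
  congr 1 with x
  simp [Real.fourierChar_apply, Circle.smul_def]
  rw [← mul_assoc (Complex.exp _), ← Complex.exp_add]
  ring_nf

theorem tendsto_integral_mul_fourierInv {g k : ℝ → ℂ} {M : ℝ} {C : ℂ} (hg : Measurable g)
    (hgM : ∀ x, ‖g x‖ ≤ M) (hk : ∀ n : ℕ, Integrable fun v => ‖v‖ ^ n * ‖k v‖)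
    (hkm : AEStronglyMeasurable k) (hk₀ : ∀ x, 𝓕 k x ≠ 0)
    (hC : Tendsto (fun t => ∫ v, k v * g (t - v)) atTop (𝓝 C))
    {φ : ℝ → ℂ} (hφ : ContDiff ℝ ∞ φ) (hφc : HasCompactSupport φ) :
    Tendsto (fun t => ∫ u, g (t - u) * 𝓕⁻ φ u) atTop (𝓝 (C * φ 0 / 𝓕 k 0)) := by
  have hki : Integrable k := (integrable_norm_iff hkm).1 (by simpa using hk 0)
  have hK : ContDiff ℝ ∞ (𝓕 k) := Real.contDiff_fourier fun n _ => hk n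
  have hψc : HasCompactSupport (fun x => (𝓕 k x)⁻¹ * φ x) := hφc.mul_left
  let ψ : SchwartzMap ℝ ℂ := hψc.toSchwartzMap ((hK.inv hk₀).mul hφ)
  have hφψ : φ = fun x => 𝓕 k x * ψ x := by
    ext x
    change _ = 𝓕 k x * ((𝓕 k x)⁻¹ * φ x)
    rw [mul_inv_cancel_left₀ (hk₀ x)]
  have hw : Integrable (𝓕⁻ (ψ : ℝ → ℂ)) := by
    rw [← SchwartzMap.fourierInv_coe]
    exact (𝓕⁻ ψ).integrable
  have hint : ∫ u, 𝓕⁻ (ψ : ℝ → ℂ) u = ψ 0 := by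
    have h : 𝓕 (𝓕⁻ ψ) 0 = ψ 0 := by simp
    rw [SchwartzMap.fourier_coe, Real.fourier_eq', SchwartzMap.fourierInv_coe] at h
    simpa using h
  have hlim : C * φ 0 / 𝓕 k 0 = ∫ u, 𝓕⁻ (ψ : ℝ → ℂ) u * C := by
    rw [integral_mul_const, hint, hφψ]
    field_simp [hk₀ 0]
  rw [hlim, hφψ]
  simp_rw [← integral_mul_fourierInv_sub hki ψ.integrable,
    integral_mul_integral_mul_sub hg hgM hki hw]
  refine tendsto_integral_filter_of_dominated_convergence
    (fun u => ‖𝓕⁻ (ψ : ℝ → ℂ) u‖ * ((∫ v, ‖k v‖) * M)) ?_ ?_ (hw.norm.mul_const _) ?_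
  · refine Eventually.of_forall fun t => hw.aestronglyMeasurable.mul ?_
    refine AEStronglyMeasurable.integral_prod_right'
      (f := fun p : ℝ × ℝ => k p.2 * g (t - p.1 - p.2)) ?_
    exact hkm.comp_snd.mul (hg.comp (by fun_prop)).aestronglyMeasurable
  · refine Eventually.of_forall fun t => ae_of_all _ fun u => ?_
    rw [norm_mul]
    gcongr
    rw [← integral_mul_const]
    refine norm_integral_le_of_norm_le (hki.norm.mul_const _) (ae_of_all _ fun v => ?_)
    rw [norm_mul]
    gcongr
    exact hgM _
  · refine ae_of_all _ fun u => tendsto_const_nhds.mul ?_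
    exact hC.comp (tendsto_atTop_add_const_right _ (-u) tendsto_id)

theorem tendsto_of_tendsto_integral_dilation {g f : ℝ → ℝ} {M B L : ℝ} (hg : Measurable g)
    (hgM : ∀ t, |g t| ≤ M) (hB : 0 ≤ B)
    (hslow : ∀ t, 0 ≤ t → ∀ h, 0 ≤ h → g t - B * h ≤ g (t + h))
    (hf₀ : ∀ u, 0 ≤ f u) (hf : Integrable f) (hf₁ : Integrable fun u => |u| * f u)
    (hfint : ∫ u, f u = 1)
    (hL : ∀ r : ℝ, 0 < r → Tendsto (fun t => ∫ u, g (t - u / r) * f u) atTop (𝓝 L)) :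
    Tendsto g atTop (𝓝 L) := by
  have hM : 0 ≤ M := (abs_nonneg _).trans (hgM 0)
  set m := ∫ u, |u| * f u with hm
  have hm0 : 0 ≤ m := integral_nonneg fun u => mul_nonneg (abs_nonneg _) (hf₀ u)
  have hint (t r : ℝ) : Integrable fun u => g (t - u / r) * f u :=
    hf.bdd_mul (c := M) (hg.comp (by fun_prop)).aestronglyMeasurable
      (ae_of_all _ fun u => hgM _)
  have hint' (t a b : ℝ) : Integrable fun u => (t + a + b * |u|) * f u := by
    simp_rw [add_mul (t + a), mul_assoc]
    exact (hf.const_mul _).add (hf₁.const_mul _)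
  have hval (t a b : ℝ) : ∫ u, (t + a + b * |u|) * f u = t + a + b * m := by
    simp_rw [add_mul (t + a), mul_assoc]
    rw [integral_add (hf.const_mul _) (hf₁.const_mul _), integral_const_mul, integral_const_mul,
      hfint, mul_one]
  have hup (δ r t : ℝ) (hδ : 0 < δ) (hr : 0 < r) (ht : 0 ≤ t) :
      g t - 2 * B * δ - 2 * M / (δ * r) * m ≤ ∫ u, g (t + δ - u / r) * f u := by
    have := hval (g t) (-(2 * B * δ)) (-(2 * M / (δ * r)))
    rw [show g t - 2 * B * δ - 2 * M / (δ * r) * m = g t + -(2 * B * δ) + -(2 * M / (δ * r)) * m by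
      ring, ← this]
    refine integral_mono (hint' _ _ _) (hint _ _) fun u => ?_
    refine mul_le_mul_of_nonneg_right ?_ (hf₀ u)
    have e : 2 * M / (δ * r) * |u| = 2 * M * (|u / r| / δ) := by
      rw [abs_div, abs_of_pos hr]; field_simp
    rw [neg_mul, e]
    by_cases hu : |u / r| ≤ δ
    · have h1 := abs_le.1 hu
      have h2 := hslow t ht (δ - u / r) (by linarith)
      rw [← add_sub_assoc] at h2
      have h3 : 0 ≤ 2 * M * (|u / r| / δ) := by positivity
      nlinarith
    · have h1 : 1 ≤ |u / r| / δ := by rw [le_div_iff₀ hδ]; linarith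
      have h2 := abs_le.1 (hgM t)
      have h3 := abs_le.1 (hgM (t + δ - u / r))
      have h4 : 0 ≤ 2 * B * δ := by positivity
      nlinarith
  have hdown (δ r t : ℝ) (hδ : 0 < δ) (hr : 0 < r) (ht : 2 * δ ≤ t) :
      ∫ u, g (t - δ - u / r) * f u ≤ g t + 2 * B * δ + 2 * M / (δ * r) * m := by
    rw [← hval (g t) (2 * B * δ) (2 * M / (δ * r))]
    refine integral_mono (hint _ _) (hint' _ _ _) fun u => ?_
    refine mul_le_mul_of_nonneg_right ?_ (hf₀ u)
    have e : 2 * M / (δ * r) * |u| = 2 * M * (|u / r| / δ) := by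
      rw [abs_div, abs_of_pos hr]; field_simp
    rw [e]
    by_cases hu : |u / r| ≤ δ
    · have h1 := abs_le.1 hu
      have h2 := hslow (t - δ - u / r) (by linarith) (δ + u / r) (by linarith)
      rw [show t - δ - u / r + (δ + u / r) = t by ring] at h2
      have h3 : 0 ≤ 2 * M * (|u / r| / δ) := by positivity
      nlinarith
    · have h1 : 1 ≤ |u / r| / δ := by rw [le_div_iff₀ hδ]; linarith
      have h2 := abs_le.1 (hgM t)
      have h3 := abs_le.1 (hgM (t - δ - u / r))
      have h4 : 0 ≤ 2 * B * δ := by positivity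
      nlinarith
  rw [Metric.tendsto_atTop']
  intro ε hε
  obtain ⟨δ, hδ, hδε⟩ : ∃ δ > 0, 2 * B * δ < ε / 4 := by
    refine ⟨ε / (8 * B + 8), by positivity, ?_⟩
    rw [mul_div_assoc', div_lt_iff₀ (by positivity)]
    nlinarith
  obtain ⟨r, hr, hrε⟩ : ∃ r > 0, 2 * M / (δ * r) * m < ε / 4 := by
    refine ⟨8 * (M * m + 1) / (δ * ε), by positivity, ?_⟩
    have : 0 ≤ M * m := by positivity
    rw [show 2 * M / (δ * (8 * (M * m + 1) / (δ * ε))) * m = (M * m) / (M * m + 1) * (ε / 4) by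
      field_simp; ring]
    exact mul_lt_of_lt_one_left (by positivity) ((div_lt_one (by positivity)).2 (by linarith))
  obtain ⟨N, hN⟩ := (Metric.tendsto_atTop.1 (hL r hr)) (ε / 2) (by positivity)
  refine ⟨max (2 * δ) (N + δ), fun t ht => ?_⟩
  obtain ⟨ht₁, ht₂⟩ := max_lt_iff.1 ht
  have h₁ := hup δ r t hδ hr (by linarith)
  have h₂ := hdown δ r t hδ hr ht₁.le
  have h₃ := hN (t + δ) (by linarith)
  have h₄ := hN (t - δ) (by linarith)
  rw [Real.dist_eq, abs_lt] at h₃ h₄ ⊢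
  constructor <;> linarith

theorem exists_nonneg_eq_fourierInv : ∃ (φ : ℝ → ℂ) (f : ℝ → ℝ), ContDiff ℝ ∞ φ ∧
    HasCompactSupport φ ∧ (∀ u, 𝓕⁻ φ u = f u) ∧ (∀ u, 0 ≤ f u) ∧ Integrable f ∧
    (Integrable fun u => |u| * f u) ∧ ∫ u, f u = 1 ∧ φ 0 = 1 := by
  let b : ContDiffBump (0 : ℝ) := ⟨1, 2, one_pos, one_lt_two⟩
  let β : ℝ → ℂ := fun x => (b x : ℂ)
  have hβc : HasCompactSupport β := b.hasCompactSupport.comp_left Complex.ofReal_zero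
  have hβ : ContDiff ℝ ∞ β := Complex.ofRealCLM.contDiff.comp b.contDiff
  have hβi : Integrable β := hβ.continuous.integrable_of_hasCompactSupport hβc
  let φ₀ := convolution β β (ContinuousLinearMap.mul ℂ ℂ) volume
  have hφ₀c : HasCompactSupport φ₀ := hβc.convolution _ hβc
  have hφ₀ : ContDiff ℝ ∞ φ₀ := by
    have := hβc.contDiff_convolution_right (𝕜 := ℝ) (ContinuousLinearMap.mul ℝ ℂ) (μ := volume)
      hβi.locallyIntegrable hβ
    exact this
  let c : ℝ := ∫ x, b x * b x
  have hc : 0 < c := by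
    have hcont : Continuous fun x => b x * b x := b.continuous.mul b.continuous
    refine hcont.integral_pos_of_hasCompactSupport_nonneg_nonzero (x := 0)
      b.hasCompactSupport.mul_left (fun x => mul_nonneg b.nonneg b.nonneg) ?_
    have : b 0 = 1 := b.one_of_mem_closedBall (by simp [b])
    simp [this]
  have hφ₀0 : φ₀ 0 = c := by
    simp only [φ₀, convolution, c, zero_sub, ContinuousLinearMap.mul_apply', β, b.neg]
    rw [← integral_complex_ofReal]
    simp
  have hre (u : ℝ) : ((𝓕 β u).re : ℂ) = 𝓕 β u := by
    rw [← Complex.conj_eq_iff_re]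
    rw [Real.fourier_eq', ← integral_conj, ← integral_neg_eq_self]
    congr 1 with x
    simp [β, b.neg, ← Complex.exp_conj, map_ofNat]
  let S : SchwartzMap ℝ ℂ := (hφ₀c.mul_left (f := fun _ => (c⁻¹ : ℂ))).toSchwartzMap
    (contDiff_const.mul hφ₀)
  have hS : (S : ℝ → ℂ) = fun x => (c⁻¹ : ℂ) * φ₀ x := rfl
  have hSf (u : ℝ) : 𝓕⁻ (S : ℝ → ℂ) u = ((c⁻¹ * (𝓕 β (-u)).re ^ 2 : ℝ) : ℂ) := by
    push_cast
    rw [hre, pow_two, ← Real.fourier_mul_convolution_eq hβi hβi, Real.fourierInv_eq_fourier_neg, hS,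
      Real.fourier_eq', Real.fourier_eq', ← integral_const_mul]
    congr 1 with x
    simp only [smul_eq_mul]
    ring
  have hfe : (fun u : ℝ => c⁻¹ * (𝓕 β (-u)).re ^ 2) = fun u => ‖(𝓕⁻ S) u‖ := by
    ext u
    rw [SchwartzMap.fourierInv_coe, hSf, Complex.norm_real, Real.norm_of_nonneg (by positivity)]
  refine ⟨S, fun u => c⁻¹ * (𝓕 β (-u)).re ^ 2, S.smooth _, ?_, hSf, fun u => by positivity, ?_, ?_,
    ?_, ?_⟩
  · exact hφ₀c.mul_left
  · rw [hfe]
    exact (𝓕⁻ S).integrable.norm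
  · have (u : ℝ) : c⁻¹ * (𝓕 β (-u)).re ^ 2 = ‖(𝓕⁻ S) u‖ := congrFun hfe u
    simp_rw [this]
    refine ((𝓕⁻ S).integrable_pow_mul volume 1).congr (ae_of_all _ fun u => ?_)
    simp only [pow_one, Real.norm_eq_abs]
  · have h : 𝓕 (𝓕⁻ S) 0 = S 0 := by simp
    rw [SchwartzMap.fourier_coe, Real.fourier_eq', SchwartzMap.fourierInv_coe] at h
    simp_rw [hSf] at h
    simp only [inner_zero_right, mul_zero, Complex.ofReal_zero, zero_mul, Complex.exp_zero,
      one_smul, hS, hφ₀0] at h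
    rw [integral_complex_ofReal, inv_mul_cancel₀ (by exact_mod_cast hc.ne')] at h
    exact_mod_cast h
  · rw [hS]
    simp only [hφ₀0]
    exact inv_mul_cancel₀ (by exact_mod_cast hc.ne')

theorem fourierInv_comp_div (φ : ℝ → ℂ) {r : ℝ} (hr : 0 < r) (u : ℝ) :
    𝓕⁻ (fun x => φ (x / r)) u = r * 𝓕⁻ φ (r * u) := by
  rw [Real.fourierInv_eq', Real.fourierInv_eq']
  have := Measure.integral_comp_div
    (fun x : ℝ => Complex.exp (↑(2 * Real.pi * inner ℝ x (r * u)) * Complex.I) • φ x) r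
  rw [abs_of_pos hr, Complex.real_smul] at this
  rw [← this]
  congr 1 with x
  congr 5
  simp
  field_simp

theorem integral_comp_sub_mul_dilation (g f : ℝ → ℂ) {r : ℝ} (hr : 0 < r) (t : ℝ) :
    ∫ u, g (t - u) * (r * f (r * u)) = ∫ u, g (t - u / r) * f u := by
  have := Measure.integral_comp_mul_left (fun u => g (t - u / r) * f u) r
  rw [abs_of_pos (inv_pos.2 hr), Complex.real_smul] at this
  have h : (r : ℂ) ≠ 0 := by exact_mod_cast hr.ne'
  rw [Complex.ofReal_inv, eq_inv_mul_iff_mul_eq₀ h, ← integral_const_mul] at this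
  rw [← this]
  congr 1 with u
  rw [mul_div_cancel_left₀ _ hr.ne']
  ring

/-- A form of Wiener's Tauberian theorem, for kernels all of whose moments are finite. -/
theorem exists_tendsto_of_tendsto_convolution {g : ℝ → ℝ} {k : ℝ → ℂ} {M B : ℝ} {C : ℂ}
    (hg : Measurable g) (hgM : ∀ x, |g x| ≤ M) (hB : 0 ≤ B)
    (hslow : ∀ t, 0 ≤ t → ∀ h, 0 ≤ h → g t - B * h ≤ g (t + h))
    (hkm : AEStronglyMeasurable k) (hk : ∀ n : ℕ, Integrable fun v => ‖v‖ ^ n * ‖k v‖)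
    (hk₀ : ∀ x, 𝓕 k x ≠ 0)
    (hC : Tendsto (fun t => ∫ v, k v * g (t - v)) atTop (𝓝 C)) :
    ∃ L, Tendsto g atTop (𝓝 L) := by
  obtain ⟨φ, f, hφ, hφc, hφf, hf₀, hf, hf₁, hfint, hφ0⟩ := exists_nonneg_eq_fourierInv
  refine ⟨(C / 𝓕 k 0).re, tendsto_of_tendsto_integral_dilation hg hgM hB hslow hf₀ hf hf₁ hfint
    fun r hr => ?_⟩
  have h₁ : HasCompactSupport fun x => φ (x / r) := by
    simpa [div_eq_inv_mul] using hφc.comp_smul (inv_ne_zero hr.ne')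
  have h₂ := tendsto_integral_mul_fourierInv (g := fun x => (g x : ℂ)) (M := M)
    (Complex.measurable_ofReal.comp hg) (fun x => by simpa using hgM x) hk hkm hk₀ hC
    (φ := fun x => φ (x / r)) (hφ.comp (contDiff_id.div_const r)) h₁
  simp_rw [fourierInv_comp_div φ hr, hφf] at h₂
  simp_rw [integral_comp_sub_mul_dilation (fun x => (g x : ℂ)) (fun x => (f x : ℂ)) hr, zero_div,
    hφ0, mul_one] at h₂
  refine ((Complex.continuous_re.tendsto _).comp h₂).congr fun t => ?_
  simp_rw [Function.comp_apply, ← Complex.ofReal_mul]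
  rw [integral_complex_ofReal, Complex.ofReal_re]

theorem integral_exp_neg_mul_I {a y : ℝ} (hy : y ≠ 0) :
    ∫ u in (0)..a, Complex.exp (-(y * Complex.I) * u) =
      (1 - Complex.exp (-(y * Complex.I) * a)) / (y * Complex.I) := by
  have : (y * Complex.I : ℂ) ≠ 0 := mul_ne_zero (by exact_mod_cast hy) Complex.I_ne_zero
  rw [integral_exp_mul_complex (neg_ne_zero.2 this)]
  rw [Complex.ofReal_zero, mul_zero, Complex.exp_zero]
  field_simp
  ring

theorem integral_sum_indicator_mul {ι : Type*} [Fintype ι] (p : ι → ℂ) {a : ι → ℝ}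
    (ha : ∀ i, 0 ≤ a i) {G : ℝ → ℂ} (hG : ∀ i, IntervalIntegrable G volume 0 (a i)) :
    ∫ v, (∑ i, (Set.Ioc 0 (a i)).indicator (fun _ => p i) v) * G v =
      ∑ i, p i * ∫ v in (0)..(a i), G v := by
  have h (i : ι) (v : ℝ) : (Set.Ioc 0 (a i)).indicator (fun _ => p i) v * G v =
      (Set.Ioc 0 (a i)).indicator (fun v => p i * G v) v := by
    simp [Set.indicator_apply, ite_mul]
  simp_rw [Finset.sum_mul, h]
  rw [integral_finsetSum]
  · refine Finset.sum_congr rfl fun i _ => ?_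
    rw [integral_indicator measurableSet_Ioc, intervalIntegral.integral_of_le (ha i),
      integral_const_mul]
  · intro i _
    rw [integrable_indicator_iff measurableSet_Ioc]
    exact ((hG i).1).const_mul _

/-- A renewal-type theorem for bounded, slowly decreasing solutions of `g = ∑ pᵢ g(· - aᵢ)`, where
the weights `pᵢ` sum to one but may be negative. -/
theorem exists_tendsto_of_eq_sum_translate {ι : Type*} [Fintype ι] (p a : ι → ℝ)
    (ha : ∀ i, 0 < a i) (hp : ∑ i, p i = 1) (hmean : ∑ i, p i * a i ≠ 0)
    (hline : ∀ y : ℝ, y ≠ 0 → ∑ i, (p i : ℂ) * Complex.exp (-(y * Complex.I) * a i) ≠ 1)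
    {g : ℝ → ℝ} {M B T : ℝ} (hg : Measurable g) (hgM : ∀ x, |g x| ≤ M) (hB : 0 ≤ B)
    (hslow : ∀ t, 0 ≤ t → ∀ h, 0 ≤ h → g t - B * h ≤ g (t + h))
    (hrec : ∀ t, T ≤ t → g t = ∑ i, p i * g (t - a i)) :
    ∃ L, Tendsto g atTop (𝓝 L) := by
  let k : ℝ → ℂ := fun v => ∑ i, (Set.Ioc 0 (a i)).indicator (fun _ => (p i : ℂ)) v
  have hkm : Measurable k :=
    Finset.measurable_sum _ fun i _ => measurable_const.indicator measurableSet_Ioc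
  have hgi (x y : ℝ) : IntervalIntegrable (fun t => (g t : ℂ)) volume x y :=
    (intervalIntegrable_const (c := M)).mono_fun
      (Complex.measurable_ofReal.comp hg).aestronglyMeasurable
      (ae_of_all _ fun t => by
        simpa using (hgM t).trans (le_abs_self M))
  have hgi' (t x y : ℝ) : IntervalIntegrable (fun v => (g (t - v) : ℂ)) volume x y := by
    simpa using (hgi (t - x) (t - y)).comp_sub_left t
  refine exists_tendsto_of_tendsto_convolution (k := k)
    (C := ∑ i, (p i : ℂ) * ∫ u in (T - a i)..T, (g u : ℂ)) hg hgM hB hslow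
    hkm.aestronglyMeasurable (fun n => ?_) (fun x => ?_) ?_
  · have : Integrable fun v : ℝ =>
        ∑ i, (Set.Ioc 0 (a i)).indicator (fun v => v ^ n * (p i : ℂ)) v := by
      refine integrable_finsetSum _ fun i _ => ?_
      rw [integrable_indicator_iff measurableSet_Ioc]
      exact (Continuous.integrableOn_Icc (by fun_prop)).mono_set Set.Ioc_subset_Icc_self
    refine this.norm.congr (ae_of_all _ fun v => ?_)
    have h (i : ι) : (Set.Ioc 0 (a i)).indicator (fun v : ℝ => (v : ℂ) ^ n * p i) v =
        (v : ℂ) ^ n * (Set.Ioc 0 (a i)).indicator (fun _ => (p i : ℂ)) v := by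
      simp [Set.indicator_apply, mul_ite]
    simp only [h, ← Finset.mul_sum, norm_mul, norm_pow, Complex.norm_real, k]
  · have h : 𝓕 k x = ∑ i, (p i : ℂ) *
        ∫ v in (0)..(a i), Complex.exp (-(((2 * Real.pi * x : ℝ) : ℂ) * Complex.I) * v) := by
      rw [Real.fourier_eq',
        ← integral_sum_indicator_mul _ (fun i => (ha i).le)
          fun i => Continuous.intervalIntegrable (by fun_prop) _ _]
      congr 1 with v
      rw [smul_eq_mul, mul_comm]
      congr 2
      simp
      ring
    rw [h]
    rcases eq_or_ne x 0 with rfl | hx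
    · simpa using mod_cast hmean
    · have hy : 2 * Real.pi * x ≠ 0 := by positivity
      have hyC : (((2 * Real.pi * x : ℝ) : ℂ) * Complex.I) ≠ 0 :=
        mul_ne_zero (by exact_mod_cast hy) Complex.I_ne_zero
      simp_rw [integral_exp_neg_mul_I hy, mul_div_assoc', ← Finset.sum_div, mul_sub, mul_one,
        Finset.sum_sub_distrib]
      refine div_ne_zero (sub_ne_zero.2 fun h' => hline _ hy ?_) hyC
      rw [← h']
      exact_mod_cast hp
  · refine tendsto_const_nhds.congr' ?_
    filter_upwards [eventually_ge_atTop T] with t ht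
    rw [integral_sum_indicator_mul _ (fun i => (ha i).le) fun i => hgi' t _ _]
    simp_rw [intervalIntegral.integral_comp_sub_left (fun u => (g u : ℂ)), sub_zero]
    have hshift : ∫ u in T..t, (g u : ℂ) =
        ∑ i, (p i : ℂ) * ∫ u in (T - a i)..(t - a i), (g u : ℂ) := by
      simp_rw [← intervalIntegral.integral_comp_sub_right (fun u => (g u : ℂ)),
        ← intervalIntegral.integral_const_mul]
      rw [← intervalIntegral.integral_finsetSum]
      · refine intervalIntegral.integral_congr fun u hu => ?_
        rw [Set.uIcc_of_le ht] at hu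
        rw [hrec u hu.1]
        push_cast
        rfl
      · intro i _
        refine IntervalIntegrable.const_mul ?_ _
        simpa using (hgi (T - a i) (t - a i)).comp_sub_right (a i)
    rw [← sub_eq_zero, ← Finset.sum_sub_distrib]
    simp_rw [← mul_sub]
    have hcomm (i : ι) : (∫ u in (T - a i)..T, (g u : ℂ)) - ∫ u in (t - a i)..t, (g u : ℂ) =
        (∫ u in (T - a i)..(t - a i), (g u : ℂ)) - ∫ u in T..t, (g u : ℂ) :=
      intervalIntegral.integral_interval_sub_interval_comm (hgi _ _) (hgi _ _) (hgi _ _)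
    simp_rw [hcomm, mul_sub, Finset.sum_sub_distrib]
    rw [← hshift, ← Finset.sum_mul, ← Complex.ofReal_sum, hp, Complex.ofReal_one, one_mul, sub_self]

theorem exists_abs_mul_exp_le_of_isBigO {s : ℝ → ℝ} {α : ℝ} (hα : 0 < α)
    (hs : MonotoneOn s (Set.Ici 0)) (hO : s =O[atTop] fun x : ℝ => x ^ α) :
    ∃ M, 0 ≤ M ∧ ∀ t, 0 ≤ t → |s (Real.exp t) * Real.exp (-(α * t))| ≤ M := by
  obtain ⟨C, hC, hCs⟩ := hO.exists_nonneg
  obtain ⟨X, hX⟩ := eventually_atTop.1 hCs.bound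
  refine ⟨C + |s 0| + |s (max X 0)|, by positivity, fun t ht => ?_⟩
  rw [abs_mul, abs_of_pos (Real.exp_pos _)]
  have h₁ : Real.exp (-(α * t)) ≤ 1 := Real.exp_le_one_iff.2 (by nlinarith)
  rcases le_total X (Real.exp t) with h | h
  · have h₂ := hX _ h
    rw [Real.norm_eq_abs, Real.norm_eq_abs, ← Real.exp_mul, abs_of_pos (Real.exp_pos _)] at h₂
    calc |s (Real.exp t)| * Real.exp (-(α * t))
        ≤ C * Real.exp (t * α) * Real.exp (-(α * t)) := by gcongr
      _ = C := by rw [mul_assoc, ← Real.exp_add]; ring_nf; simp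
      _ ≤ C + |s 0| + |s (max X 0)| := by linarith [abs_nonneg (s 0), abs_nonneg (s (max X 0))]
  · have h₂ : s 0 ≤ s (Real.exp t) := hs (Set.mem_Ici.2 le_rfl) (Real.exp_pos t).le
      (Real.exp_pos t).le
    have h₃ : s (Real.exp t) ≤ s (max X 0) := hs (Real.exp_pos t).le (le_max_right X 0)
      (h.trans (le_max_left X 0))
    have h₄ : |s (Real.exp t)| ≤ |s 0| + |s (max X 0)| := by
      rw [abs_le]
      constructor
      · linarith [neg_abs_le (s 0), abs_nonneg (s (max X 0))]
      · linarith [le_abs_self (s (max X 0)), abs_nonneg (s 0)]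
    calc |s (Real.exp t)| * Real.exp (-(α * t)) ≤ |s (Real.exp t)| * 1 := by gcongr
      _ ≤ C + |s 0| + |s (max X 0)| := by linarith

end Tauberian

/-- **Theorem 3.** Let `F(z) = Σ_i c_i m_i^{-z}` with `m_i > 1`.
Suppose `F(α) = 1` has a unique positive solution `α₀`, that `F(α₀ + ix) ≠ 1`
for every real `x ≠ 0`, and `F'(α₀) ≠ 0`. If a non-decreasing function `s` on
`[0,∞)` with `s(x) = s(⌊x⌋)` satisfies `s(x) = Σ_i c_i s(x/m_i)` for `x ≥ N₀`
and `s(x) = O(x^{α₀})`, then `s(x)/x^{α₀}` tends to a finite limit. -/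
theorem tauberian_ratio_limit (l : ℕ) (c : Fin l → ℝ) (m : Fin l → ℝ)
    (hm : ∀ i, 1 < m i) (α₀ : ℝ) (hα₀ : 0 < α₀)
    (hroot : ∑ i, c i * (m i) ^ (-α₀) = 1)
    (huniq : ∀ β : ℝ, 0 < β → ∑ i, c i * (m i) ^ (-β) = 1 → β = α₀)
    (hline : ∀ x : ℝ, x ≠ 0 →
      (∑ i, (c i : ℂ) * (m i : ℂ) ^ (-((α₀ : ℂ) + Complex.I * (x : ℂ)))) ≠ 1)
    (hderiv : deriv (fun x : ℝ => ∑ i, c i * (m i) ^ (-x)) α₀ ≠ 0)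
    (s : ℝ → ℝ) (hmono : MonotoneOn s (Set.Ici 0))
    (hfloor : ∀ x : ℝ, 0 ≤ x → s x = s (⌊x⌋ : ℤ))
    (N₀ : ℝ) (hN₀ : 0 < N₀)
    (hrec : ∀ x : ℝ, N₀ ≤ x → s x = ∑ i, c i * s (x / m i))
    (hO : s =O[atTop] fun x : ℝ => x ^ α₀) :
    ∃ L : ℝ, Tendsto (fun x : ℝ => s x / x ^ α₀) atTop (nhds L) := by
  have hm0 (i : Fin l) : 0 < m i := one_pos.trans (hm i)
  let a : Fin l → ℝ := fun i => Real.log (m i)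
  have ha (i : Fin l) : 0 < a i := Real.log_pos (hm i)
  have hexp (i : Fin l) : Real.exp (a i) = m i := Real.exp_log (hm0 i)
  obtain ⟨M, hM, hsM⟩ := exists_abs_mul_exp_le_of_isBigO hα₀ hmono hO
  let g : ℝ → ℝ := (Set.Ici 0).indicator fun t => s (Real.exp t) * Real.exp (-(α₀ * t))
  have hg0 {t : ℝ} (ht : 0 ≤ t) : g t = s (Real.exp t) * Real.exp (-(α₀ * t)) :=
    Set.indicator_of_mem (Set.mem_Ici.2 ht) _
  have hgM (t : ℝ) : |g t| ≤ M := by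
    rcases le_or_gt 0 t with ht | ht
    · rw [hg0 ht]
      exact hsM t ht
    · simpa [g, Set.indicator_of_notMem (Set.notMem_Ici.2 ht)] using hM
  have hsexp : Monotone fun t => s (Real.exp t) := fun t u htu =>
    hmono (Real.exp_pos t).le (Real.exp_pos u).le (Real.exp_le_exp.2 htu)
  have hgmeas : Measurable g := by
    refine Measurable.indicator (hsexp.measurable.mul ?_) measurableSet_Ici
    fun_prop
  have hslow (t : ℝ) (ht : 0 ≤ t) (h : ℝ) (hh : 0 ≤ h) : g t - α₀ * M * h ≤ g (t + h) := by
    have h₁ : Real.exp (-(α₀ * h)) * g t ≤ g (t + h) := by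
      rw [hg0 ht, hg0 (by linarith), mul_left_comm, ← Real.exp_add]
      rw [show -(α₀ * h) + -(α₀ * t) = -(α₀ * (t + h)) by ring]
      exact mul_le_mul_of_nonneg_right (hsexp (by linarith)) (Real.exp_pos _).le
    have h₂ : 1 - α₀ * h ≤ Real.exp (-(α₀ * h)) := Real.one_sub_le_exp_neg _
    have h₃ : Real.exp (-(α₀ * h)) ≤ 1 := Real.exp_le_one_iff.2 (by nlinarith)
    have h₄ := abs_le.1 (hgM t)
    nlinarith
  have hpow (i : Fin l) (x : ℝ) : m i ^ x = Real.exp (a i * x) := Real.rpow_def_of_pos (hm0 i) x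
  have hderiv' : HasDerivAt (fun x : ℝ => ∑ i, c i * m i ^ (-x))
      (-∑ i, c i * m i ^ (-α₀) * a i) α₀ := by
    rw [← Finset.sum_neg_distrib]
    refine HasDerivAt.fun_sum fun i _ => ?_
    refine (((hasDerivAt_neg α₀).const_rpow (hm0 i)).const_mul (c i)).congr_deriv ?_
    ring
  have hlim : ∃ L, Tendsto g atTop (nhds L) := by
    refine exists_tendsto_of_eq_sum_translate (fun i => c i * m i ^ (-α₀)) a ha hroot
      (fun h => hderiv (by rw [hderiv'.deriv, h, neg_zero])) (fun y hy => ?_)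
      (T := |Real.log N₀| + ∑ i, a i) hgmeas hgM (mul_nonneg hα₀.le hM) hslow fun t ht => ?_
    · refine Eq.trans_ne (Finset.sum_congr rfl fun i _ => ?_) (hline y hy)
      rw [Complex.ofReal_mul, mul_assoc]
      congr 1
      rw [hpow, Complex.ofReal_exp, ← Complex.exp_add,
        Complex.cpow_def_of_ne_zero (by exact_mod_cast (hm0 i).ne'), ← Complex.ofReal_log (hm0 i).le]
      congr 1
      push_cast
      simp only [a]
      ring
    · have ht₁ : 0 ≤ |Real.log N₀| := abs_nonneg _
      have hsum : 0 ≤ ∑ i, a i := Finset.sum_nonneg fun i _ => (ha i).le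
      have hN : N₀ ≤ Real.exp t := by
        rw [← Real.log_le_iff_le_exp hN₀]
        linarith [le_abs_self (Real.log N₀)]
      rw [hg0 (by linarith), hrec _ hN, Finset.sum_mul]
      refine Finset.sum_congr rfl fun i _ => ?_
      have hi : a i ≤ ∑ i, a i :=
        Finset.single_le_sum (fun i _ => (ha i).le) (Finset.mem_univ i)
      rw [hg0 (by linarith), Real.exp_sub, hexp, hpow]
      rw [show -(α₀ * t) = a i * -α₀ + -(α₀ * (t - a i)) by ring, Real.exp_add]
      ring
  obtain ⟨L, hL⟩ := hlim
  refine ⟨L, (hL.comp Real.tendsto_log_atTop).congr' ?_⟩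
  filter_upwards [eventually_ge_atTop 1] with x hx
  have hx0 : 0 < x := by linarith
  rw [Function.comp_apply, hg0 (Real.log_nonneg hx), Real.exp_log hx0, Real.exp_neg,
    Real.rpow_def_of_pos hx0, div_eq_mul_inv, mul_comm α₀]
end
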